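/- arXiv:1905.13633 — 12 statements merged into one kernel-verified Lean document; each statement's English description precedes it below -/
import Mathlib

section
/- Theorem 1 (GDU property), neural part: Assume F(s,θ) = ∇_s Φ(s,θ) for a C³ primitive function Φ, and assume the first-phase trajectory satisfies s_{T−K} = s_{T−K+1} = … = s_T = s_* for some 0 < K ≤ T (so s_* is a fixed point of F(·,θ)). Then for every t with 0 ≤ t ≤ K, the EP neural update converges as β → 0 to the negative of the corresponding BPTT gradient: lim_{β→0} Δ_s^EP(β,t) = −∇_s^BPTT(t). -/
open Filter Topology

/-- Derivative at `β = 0` of the nudged dynamics. -/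
theorem ep_aux {E : Type*} [NormedAddCommGroup E] [NormedSpace ℝ E]
    (f g : E → E) (p : E) (A B : E →L[ℝ] E) (hp : f p = p)
    (hf : HasFDerivAt f A p) (hg : HasFDerivAt g B p)
    (w : ℝ → ℕ → E) (h0 : ∀ β, w β 0 = p)
    (hw : ∀ β t, w β (t + 1) = f (w β t) - β • g (w β t)) (t : ℕ) :
    w 0 t = p ∧ ∃ d : E, HasDerivAt (fun β => w β t) d 0 ∧
      HasDerivAt (fun β => w β (t + 1)) (d - (A ^ t) (g p)) 0 := by
  have step : ∀ t d, w 0 t = p → HasDerivAt (fun β => w β t) d 0 →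
      HasDerivAt (fun β => w β (t + 1)) (A d - g p) 0 := by
    intro t d h1 h2
    have a1 : HasDerivAt (fun β => f (w β t)) (A d) 0 :=
      HasFDerivAt.comp_hasDerivAt (0 : ℝ) (by rw [h1]; exact hf) h2
    have a2 : HasDerivAt (fun β => g (w β t)) (B d) 0 :=
      HasFDerivAt.comp_hasDerivAt (0 : ℝ) (by rw [h1]; exact hg) h2
    have a3 := a1.sub ((hasDerivAt_id (0 : ℝ)).smul a2)
    simp only [id, zero_smul, one_smul, zero_add, h1] at a3
    simp only [hw]
    exact a3
  induction t with
  | zero =>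
    refine ⟨h0 0, 0, ?_, ?_⟩
    · simp only [h0]; exact hasDerivAt_const _ _
    · have := step 0 0 (h0 0) (by simp only [h0]; exact hasDerivAt_const _ _)
      simpa using this
  | succ t ih =>
    obtain ⟨h1, d, h2, h3⟩ := ih
    have e : w 0 (t + 1) = p := by rw [hw, h1, hp]; simp
    refine ⟨e, _, h3, ?_⟩
    have h4 := step (t + 1) _ e h3
    have h5 := (step t d h1 h2).unique h3
    convert h4 using 1
    rw [map_sub, ← h5, pow_succ', mul_apply_eq_comp]
    abel



/-- Theorem 1 (GDU property), neural part. -/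
theorem gdu_neural
    {E : Type*} [NormedAddCommGroup E] [InnerProductSpace ℝ E] [FiniteDimensional ℝ E]
    {Θ : Type*} [NormedAddCommGroup Θ] [InnerProductSpace ℝ Θ] [FiniteDimensional ℝ Θ]
    (F : E × Θ → E) (ℓ : E → ℝ) (Φ : E × Θ → ℝ)
    (hF : ContDiff ℝ 2 F) (hℓ : ContDiff ℝ 2 ℓ) (hΦ : ContDiff ℝ 3 Φ)
    (hFΦ : ∀ (u : E) (θ : Θ), F (u, θ) = gradient (fun v => Φ (v, θ)) u)
    (θ : Θ) (T K : ℕ) (hK0 : 0 < K) (hKT : K ≤ T)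
    (s : ℕ → E) (hs : ∀ t, t < T → s (t + 1) = F (s t, θ))
    (sstar : E) (hstar : ∀ t, T - K ≤ t → t ≤ T → s t = sstar)
    (sβ : ℝ → ℕ → E)
    (hsβ0 : ∀ β : ℝ, sβ β 0 = sstar)
    (hsβrec : ∀ β : ℝ, 0 < β → ∀ t, sβ β (t + 1) = F (sβ β t, θ) - β • gradient ℓ (sβ β t))
    (t : ℕ) (ht : t ≤ K) :
    Filter.Tendsto (fun β : ℝ => β⁻¹ • (sβ β (t + 1) - sβ β t)) (𝓝[>] (0 : ℝ))
      (𝓝 (-(gradient (fun u => ℓ ((fun v => F (v, θ))^[t] u)) (s (T - t))))) := by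

  have hsT : s (T - t) = sstar := hstar _ (by omega) (by omega)
  have hp : F (sstar, θ) = sstar := by
    have h1 := hs (T - 1) (by omega)
    rw [hstar (T - 1) (by omega) (by omega), Nat.sub_add_cancel (by omega),
      hstar T (by omega) le_rfl] at h1
    exact h1.symm
  have hfC : ContDiff ℝ 2 (fun v => F (v, θ)) := by fun_prop
  have hf : HasFDerivAt (fun v => F (v, θ)) (fderiv ℝ (fun v => F (v, θ)) sstar) sstar :=
    (hfC.differentiable (by norm_num) sstar).hasFDerivAt
  set A := fderiv ℝ (fun v => F (v, θ)) sstar with hA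
  have hgd : Differentiable ℝ (gradient ℓ) := by
    have h1 : Differentiable ℝ (fderiv ℝ ℓ) :=
      (hℓ.fderiv_right (m := 1) (by norm_num)).differentiable (by norm_num)
    exact (InnerProductSpace.toDual ℝ E).symm.toContinuousLinearEquiv.differentiable.comp h1
  have hsym : ∀ u v, inner ℝ (A u) v = inner ℝ u (A v) := by
    intro u v
    have hφ : ∀ y, HasFDerivAt (fun v => Φ (v, θ))
        (InnerProductSpace.toDual ℝ E (F (y, θ))) y := by
      intro y
      rw [hFΦ]
      have hd : DifferentiableAt ℝ (fun v => Φ (v, θ)) y := by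
        have : ContDiff ℝ 3 (fun v => Φ (v, θ)) := by fun_prop
        exact this.differentiable (by norm_num) y
      exact hd.hasGradientAt
    let J : E →L[ℝ] StrongDual ℝ E := LinearMap.toContinuousLinearMap
      { toFun := fun x => InnerProductSpace.toDual ℝ E x
        map_add' := fun x y => by simp
        map_smul' := fun c x => by simp }
    have h2 : HasFDerivAt (fun y => InnerProductSpace.toDual ℝ E (F (y, θ)))
        (J.comp A) sstar := J.hasFDerivAt.comp sstar hf
    have h3 := second_derivative_symmetric hφ h2 u v
    have h4 : inner ℝ (A u) v = inner ℝ (A v) u := h3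
    rw [h4, real_inner_comm]
  have hsymt : ∀ n u v, inner ℝ ((A ^ n) u) v = inner ℝ u ((A ^ n) v) := by
    intro n
    induction n with
    | zero => simp
    | succ n ih =>
      intro u v
      rw [pow_succ, mul_apply_eq_comp, ih, hsym,
        ← mul_apply_eq_comp, ← pow_succ', pow_succ]
  have hgrad : gradient (fun u => ℓ ((fun v => F (v, θ))^[t] u)) sstar
      = (A ^ t) (gradient ℓ sstar) := by
    apply HasGradientAt.gradient
    rw [hasGradientAt_iff_hasFDerivAt]
    have h1 : HasFDerivAt ((fun v => F (v, θ))^[t]) (A ^ t) sstar := hf.iterate hp t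
    have hfix : (fun v => F (v, θ))^[t] sstar = sstar := Function.iterate_fixed hp t
    have h2 : HasFDerivAt ℓ (InnerProductSpace.toDual ℝ E (gradient ℓ sstar))
        ((fun v => F (v, θ))^[t] sstar) := by
      rw [hfix]
      exact (hℓ.differentiable (by norm_num) sstar).hasGradientAt
    have h3 := h2.comp sstar h1
    have h4 : InnerProductSpace.toDual ℝ E ((A ^ t) (gradient ℓ sstar))
        = (InnerProductSpace.toDual ℝ E (gradient ℓ sstar)).comp (A ^ t) := by
      ext v
      exact hsymt t _ v
    rw [h4]
    exact h3
  rw [hsT, hgrad]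
  let w : ℝ → ℕ → E := fun β n =>
    Nat.rec sstar (fun _ x => F (x, θ) - β • gradient ℓ x) n
  have hwe : ∀ β, 0 < β → ∀ n, sβ β n = w β n := by
    intro β hβ n
    induction n with
    | zero => exact hsβ0 β
    | succ n ih => rw [hsβrec β hβ, ih]
  obtain ⟨e1, d, h1, h2⟩ := ep_aux (fun v => F (v, θ)) (gradient ℓ) sstar A _ hp hf
    (hgd sstar).hasFDerivAt w (fun _ => rfl) (fun _ _ => rfl) t
  have e2 : w 0 (t + 1) = sstar := by
    change F (w 0 t, θ) - (0 : ℝ) • gradient ℓ (w 0 t) = sstar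
    rw [e1, hp]; simp
  have h3 := (h2.sub h1).tendsto_slope_zero_right
  have h4 : d - (A ^ t) (gradient ℓ sstar) - d = -((A ^ t) (gradient ℓ sstar)) := by abel
  rw [h4] at h3
  refine h3.congr' ?_
  filter_upwards [self_mem_nhdsWithin] with β hβ
  simp [hwe β hβ, e1, e2]
end

section
/- Theorem 1 (GDU property), parameter part: Assume F(s,θ) = ∇_s Φ(s,θ) for a C³ primitive function Φ, and assume the first-phase trajectory satisfies s_{T−K} = s_{T−K+1} = … = s_T = s_* for some 0 < K ≤ T. Then for every t with 1 ≤ t ≤ K, the EP weight update converges as β → 0 to the negative of the corresponding BPTT gradient: lim_{β→0} Δ_θ^EP(β,t) = −∇_θ^BPTT(t). -/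
open Filter Topology

/-- The nudged trajectory, for every real `β`. -/
noncomputable def nudged {E : Type*} [NormedAddCommGroup E] [InnerProductSpace ℝ E]
    (f g : E → E) (x : E) (β : ℝ) : ℕ → E
  | 0 => x
  | (n + 1) => f (nudged f g x β n) - β • g (nudged f g x β n)

theorem nudged_zero {E : Type*} [NormedAddCommGroup E] [InnerProductSpace ℝ E]
    (f g : E → E) (x : E) (hx : f x = x) (n : ℕ) : nudged f g x 0 n = x := by
  induction n with
  | zero => rfl
  | succ n ih => simp [nudged, ih, hx]

theorem nudged_hasDerivAt {E : Type*} [NormedAddCommGroup E] [InnerProductSpace ℝ E]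
    (f g : E → E) (x : E) (hx : f x = x) (A : E →L[ℝ] E) (hf : HasFDerivAt f A x)
    (hg : DifferentiableAt ℝ g x) (n : ℕ) :
    ∃ v : E, HasDerivAt (fun β => nudged f g x β n) v 0 ∧
      HasDerivAt (fun β => nudged f g x β (n + 1)) (v - (A ^ n) (g x)) 0 := by
  have step : ∀ (n : ℕ) (v : E), HasDerivAt (fun β => nudged f g x β n) v 0 →
      HasDerivAt (fun β => nudged f g x β (n + 1)) (A v - g x) 0 := by
    intro n v hv
    have h0 := nudged_zero f g x hx n
    have h1 : HasDerivAt (fun β => f (nudged f g x β n)) (A v) 0 :=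
      HasFDerivAt.comp_hasDerivAt (0 : ℝ) (by rw [h0]; exact hf) hv
    have h2 : HasDerivAt (fun β => g (nudged f g x β n)) (fderiv ℝ g x v) 0 :=
      HasFDerivAt.comp_hasDerivAt (0 : ℝ) (by rw [h0]; exact hg.hasFDerivAt) hv
    have h3 := h1.sub ((hasDerivAt_id (0 : ℝ)).smul h2)
    simp only [id, zero_smul, one_smul, zero_add, h0] at h3
    exact h3
  induction n with
  | zero =>
    have h : HasDerivAt (fun β => nudged f g x β 0) 0 0 := hasDerivAt_const _ _
    refine ⟨0, h, ?_⟩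
    simpa using step 0 0 h
  | succ n ih =>
    obtain ⟨v, h1, h2⟩ := ih
    refine ⟨_, h2, ?_⟩
    have h3 := step _ _ h2
    have h4 := (step _ _ h1).unique h2
    convert h3 using 1
    rw [← h4, pow_succ', mul_apply_eq_comp]
    have : A v - g x = v - (A ^ n) (g x) := h4
    have e : (A ^ n) (g x) = v - (A v - g x) := by rw [this]; abel
    rw [e, map_sub]
    abel

/-- Theorem 1 (GDU property), parameter part. -/
theorem gdu_param
    {E : Type*} [NormedAddCommGroup E] [InnerProductSpace ℝ E] [FiniteDimensional ℝ E]
    {Θ : Type*} [NormedAddCommGroup Θ] [InnerProductSpace ℝ Θ] [FiniteDimensional ℝ Θ]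
    (F : E × Θ → E) (ℓ : E → ℝ) (Φ : E × Θ → ℝ)
    (hF : ContDiff ℝ 2 F) (hℓ : ContDiff ℝ 2 ℓ) (hΦ : ContDiff ℝ 3 Φ)
    (hFΦ : ∀ (u : E) (θ : Θ), F (u, θ) = gradient (fun v => Φ (v, θ)) u)
    (θ : Θ) (T K : ℕ) (hK0 : 0 < K) (hKT : K ≤ T)
    (s : ℕ → E) (hs : ∀ t, t < T → s (t + 1) = F (s t, θ))
    (sstar : E) (hstar : ∀ t, T - K ≤ t → t ≤ T → s t = sstar)
    (sβ : ℝ → ℕ → E)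
    (hsβ0 : ∀ β : ℝ, sβ β 0 = sstar)
    (hsβrec : ∀ β : ℝ, 0 < β → ∀ t, sβ β (t + 1) = F (sβ β t, θ) - β • gradient ℓ (sβ β t))
    (t : ℕ) (ht1 : 1 ≤ t) (htK : t ≤ K) :
    Filter.Tendsto
      (fun β : ℝ => β⁻¹ •
        (gradient (fun θ' => Φ (sβ β t, θ')) θ -
          gradient (fun θ' => Φ (sβ β (t - 1), θ')) θ))
      (𝓝[>] (0 : ℝ))
      (𝓝 (-(gradient (fun θ' => ℓ ((fun v => F (v, θ))^[t - 1] (F (s (T - t), θ')))) θ))) := by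
  obtain ⟨n, rfl⟩ : ∃ n, t = n + 1 := ⟨t - 1, by omega⟩
  simp only [Nat.add_sub_cancel]
  have hfix : F (sstar, θ) = sstar := by
    have h := hs (T - 1) (by omega)
    rw [hstar (T - 1) (by omega) (by omega), hstar (T - 1 + 1) (by omega) (by omega)] at h
    exact h.symm
  rw [hstar (T - (n + 1)) (by omega) (by omega)]
  set f : E → E := fun v => F (v, θ) with hf
  have hX : ∀ β : ℝ, 0 < β → ∀ m, sβ β m = nudged f (gradient ℓ) sstar β m := by
    intro β hβ m
    induction m with
    | zero => exact hsβ0 β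
    | succ m ih => rw [hsβrec β hβ, ih]; rfl
  have hΦd : Differentiable ℝ Φ := hΦ.differentiable (by norm_num)
  have hΦ1 : Differentiable ℝ (fderiv ℝ Φ) :=
    (hΦ.fderiv_right (m := 2) (by norm_num)).differentiable (by norm_num)
  have hFd : Differentiable ℝ F := hF.differentiable (by norm_num)
  have hℓd : Differentiable ℝ ℓ := hℓ.differentiable (by norm_num)
  have hgd : Differentiable ℝ (gradient ℓ) := by
    have h1 : Differentiable ℝ (fderiv ℝ ℓ) :=
      (hℓ.fderiv_right (m := 1) (by norm_num)).differentiable (by norm_num)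
    exact (InnerProductSpace.toDual ℝ E).symm.toContinuousLinearEquiv.differentiable.comp h1
  -- slices
  have hinl : ∀ (u : E) (θ' : Θ), HasFDerivAt (fun v : E => (v, θ'))
      (ContinuousLinearMap.inl ℝ E Θ) u := fun u θ' => hasFDerivAt_prodMk_left u θ'
  have hinr : ∀ (u : E) (θ' : Θ), HasFDerivAt (fun v : Θ => (u, v))
      (ContinuousLinearMap.inr ℝ E Θ) θ' := fun u θ' => hasFDerivAt_prodMk_right u θ'
  have hFin : ∀ (p : E × Θ) (w : E), inner ℝ (F p) w = fderiv ℝ Φ p (w, 0) := by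
    rintro ⟨u, θ'⟩ w
    have h := (hΦd (u, θ')).hasFDerivAt.comp u (hinl u θ')
    have h' : fderiv ℝ (fun v => Φ (v, θ')) u = _ := h.fderiv
    rw [hFΦ, gradient, h']
    simp
  set G : E → Θ := fun u => gradient (fun θ' => Φ (u, θ')) θ with hG
  have hGeq : G = fun u => (InnerProductSpace.toDual ℝ Θ).symm
      ((fderiv ℝ Φ (u, θ)).comp (ContinuousLinearMap.inr ℝ E Θ)) := by
    funext u
    have h := (hΦd (u, θ)).hasFDerivAt.comp θ (hinr u θ)
    have h' : fderiv ℝ (fun θ' => Φ (u, θ')) θ = _ := h.fderiv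
    simp only [hG, gradient, h']
  have hGin : ∀ (u : E) (w : Θ), inner ℝ (G u) w = fderiv ℝ Φ (u, θ) (0, w) := by
    intro u w
    rw [hGeq]; simp
  have hslice : DifferentiableAt ℝ (fun u : E => fderiv ℝ Φ (u, θ)) sstar :=
    DifferentiableAt.comp (g := fderiv ℝ Φ) sstar (hΦ1 (sstar, θ))
      (hinl sstar θ).differentiableAt
  have hGd : DifferentiableAt ℝ G sstar := by
    rw [hGeq]
    exact (InnerProductSpace.toDual ℝ Θ).symm.toContinuousLinearEquiv.differentiableAt.comp sstar
      (hslice.clm_comp (differentiableAt_const _))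
  set D2 := fderiv ℝ (fderiv ℝ Φ) (sstar, θ) with hD2
  have hsymm : ∀ x y, D2 x y = D2 y x := fun x y =>
    (hΦ.contDiffAt.isSymmSndFDerivAt (by simp; norm_num)) x y
  have hDF : ∀ (x : E × Θ) (w : E), inner ℝ (fderiv ℝ F (sstar, θ) x) w = D2 x (w, 0) := by
    intro x w
    have h1 := (hFd (sstar, θ)).hasFDerivAt.inner ℝ (hasFDerivAt_const w (sstar, θ))
    have h2 := (hΦ1 (sstar, θ)).hasFDerivAt.clm_apply (hasFDerivAt_const (w, (0 : Θ)) (sstar, θ))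
    simp only [hFin] at h1
    have h3 := congrArg (fun L => L x) (h1.unique h2)
    simpa using h3
  have hDG : ∀ (x : E) (w : Θ), inner ℝ (fderiv ℝ G sstar x) w = D2 (x, 0) (0, w) := by
    intro x w
    have h1 := hGd.hasFDerivAt.inner ℝ (hasFDerivAt_const w sstar)
    have h0 : HasFDerivAt (fun u : E => fderiv ℝ Φ (u, θ))
        (D2.comp (ContinuousLinearMap.inl ℝ E Θ)) sstar :=
      HasFDerivAt.comp (g := fderiv ℝ Φ) sstar (hΦ1 (sstar, θ)).hasFDerivAt (hinl sstar θ)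
    have h2 := h0.clm_apply
      (hasFDerivAt_const ((0 : E), w) sstar)
    simp only [hGin] at h1
    have h3 := congrArg (fun L => L x) (h1.unique h2)
    simpa using h3
  set A : E →L[ℝ] E := (fderiv ℝ F (sstar, θ)).comp (ContinuousLinearMap.inl ℝ E Θ) with hA
  set C : Θ →L[ℝ] E := (fderiv ℝ F (sstar, θ)).comp (ContinuousLinearMap.inr ℝ E Θ) with hC
  have hfA : HasFDerivAt f A sstar := (hFd (sstar, θ)).hasFDerivAt.comp sstar (hinl sstar θ)
  have hfC : HasFDerivAt (fun θ' => F (sstar, θ')) C θ :=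
    (hFd (sstar, θ)).hasFDerivAt.comp θ (hinr sstar θ)
  have hAs : ∀ x y, inner ℝ (A x) y = inner ℝ x (A y) := by
    intro x y
    rw [real_inner_comm (A y) x]
    simp only [hA, ContinuousLinearMap.comp_apply, ContinuousLinearMap.inl_apply, hDF]
    exact hsymm _ _
  have hAn : ∀ (m : ℕ) x y, inner ℝ ((A ^ m) x) y = inner ℝ x ((A ^ m) y) := by
    intro m
    induction m with
    | zero => intro x y; simp
    | succ m ih =>
      intro x y
      rw [pow_succ, mul_apply_eq_comp, ih, hAs, ← mul_apply_eq_comp,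
        ← pow_succ', ← pow_succ]
  -- the BPTT gradient
  have hgrad : gradient (fun θ' => ℓ (f^[n] (F (sstar, θ')))) θ =
      fderiv ℝ G sstar ((A ^ n) (gradient ℓ sstar)) := by
    have hit : HasFDerivAt (f^[n]) (A ^ n) (F (sstar, θ)) := by
      rw [hfix]; exact hfA.iterate hfix n
    have hval : f^[n] (F (sstar, θ)) = sstar := by
      rw [hfix]; exact Function.iterate_fixed hfix n
    have h1 := hit.comp θ hfC
    have h2 : HasFDerivAt ℓ (fderiv ℝ ℓ sstar) ((f^[n] ∘ fun θ' => F (sstar, θ')) θ) := by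
      simp only [Function.comp_apply, hval]; exact (hℓd sstar).hasFDerivAt
    have h3 := (h2.comp θ h1).fderiv
    have h4 : fderiv ℝ (fun θ' => ℓ (f^[n] (F (sstar, θ')))) θ = _ := h3
    refine ext_inner_right ℝ fun w => ?_
    rw [hDG, hsymm, ← hDF, gradient, h4, InnerProductSpace.toDual_symm_apply]
    have h5 : fderiv ℝ F (sstar, θ) (0, w) = C w := by simp [hC]
    rw [h5, ← hAn, real_inner_comm, gradient, InnerProductSpace.toDual_symm_apply]
    simp
  rw [hgrad]
  obtain ⟨v, hv1, hv2⟩ := nudged_hasDerivAt f (gradient ℓ) sstar hfix A hfA (hgd sstar) n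
  have hz := nudged_zero f (gradient ℓ) sstar hfix
  have k1 : HasDerivAt (fun β => G (nudged f (gradient ℓ) sstar β n)) _ 0 :=
    HasFDerivAt.comp_hasDerivAt (l := G) (l' := fderiv ℝ G sstar) (0 : ℝ) (by rw [hz]; exact hGd.hasFDerivAt) hv1
  have k2 : HasDerivAt (fun β => G (nudged f (gradient ℓ) sstar β (n + 1))) _ 0 :=
    HasFDerivAt.comp_hasDerivAt (l := G) (l' := fderiv ℝ G sstar) (0 : ℝ) (by rw [hz]; exact hGd.hasFDerivAt) hv2
  have k3 := (k2.sub k1).tendsto_slope_zero_right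
  rw [← map_sub, sub_sub_cancel_left, map_neg] at k3
  refine k3.congr' ?_
  filter_upwards [self_mem_nhdsWithin] with β hβ
  simp [hX β hβ, hz, hG]
end

section
/- Corollary 1 (BPTT gradients at the steady state): Suppose the first-phase trajectory satisfies s_{T−K} = s_{T−K+1} = … = s_T = s_* for some 0 < K ≤ T. Then for every 1 ≤ t ≤ K, ∇_s^BPTT(t) = ((D_s F(s_*, θ))^*)^t · ∇ℓ(s_*) and ∇_θ^BPTT(t) = (D_θ F(s_*, θ))^* · ((D_s F(s_*, θ))^*)^{t−1} · ∇ℓ(s_*), where ^* denotes the adjoint and powers denote composition. -/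
open Filter Topology

theorem gradient_comp_aux
    {E : Type*} [NormedAddCommGroup E] [InnerProductSpace ℝ E] [CompleteSpace E]
    {G : Type*} [NormedAddCommGroup G] [InnerProductSpace ℝ G] [CompleteSpace G]
    {l : E → ℝ} {g : G → E} {x : G} {y : E} {A : G →L[ℝ] E} (hy : g x = y)
    (hl : DifferentiableAt ℝ l y) (hg : HasFDerivAt g A x) :
    gradient (fun u => l (g u)) x = ContinuousLinearMap.adjoint A (gradient l y) := by
  subst hy
  have h1 : HasFDerivAt (fun u => l (g u)) ((fderiv ℝ l (g x)).comp A) x :=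
    hl.hasFDerivAt.comp x hg
  refine ext_inner_right ℝ fun v => ?_
  rw [ContinuousLinearMap.adjoint_inner_left]
  simp only [gradient, InnerProductSpace.toDual_symm_apply]
  rw [h1.fderiv]
  rfl

/-- Corollary 1 (BPTT gradients at the steady state). -/
theorem bptt_gradients_steady_state
    {E : Type*} [NormedAddCommGroup E] [InnerProductSpace ℝ E] [FiniteDimensional ℝ E]
    {Θ : Type*} [NormedAddCommGroup Θ] [InnerProductSpace ℝ Θ] [FiniteDimensional ℝ Θ]
    (F : E × Θ → E) (ℓ : E → ℝ)
    (hF : ContDiff ℝ 1 F) (hℓ : ContDiff ℝ 1 ℓ)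
    (θ : Θ) (T K : ℕ) (hK0 : 0 < K) (hKT : K ≤ T)
    (s : ℕ → E) (hs : ∀ t, t < T → s (t + 1) = F (s t, θ))
    (sstar : E) (hstar : ∀ t, T - K ≤ t → t ≤ T → s t = sstar) :
    ∀ t, 1 ≤ t → t ≤ K →
      gradient (fun u => ℓ ((fun v => F (v, θ))^[t] u)) (s (T - t)) =
        ((ContinuousLinearMap.adjoint (fderiv ℝ (fun u => F (u, θ)) sstar)) ^ t)
          (gradient ℓ sstar) ∧
      gradient (fun θ' => ℓ ((fun v => F (v, θ))^[t - 1] (F (s (T - t), θ')))) θ =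
        (ContinuousLinearMap.adjoint (fderiv ℝ (fun θ' => F (sstar, θ')) θ))
          (((ContinuousLinearMap.adjoint (fderiv ℝ (fun u => F (u, θ)) sstar)) ^ (t - 1))
            (gradient ℓ sstar)) := by
  intro t ht1 htK
  have hsT : s (T - t) = sstar := hstar _ (by omega) (by omega)
  have hfix : F (sstar, θ) = sstar := by
    have h := hs (T - K) (by omega)
    rw [hstar (T - K) (by omega) (by omega), hstar (T - K + 1) (by omega) (by omega)] at h
    exact h.symm
  have hFd : Differentiable ℝ F := hF.differentiable (by norm_num)
  have hld : Differentiable ℝ ℓ := hℓ.differentiable (by norm_num)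
  have hA : HasFDerivAt (fun u => F (u, θ)) (fderiv ℝ (fun u => F (u, θ)) sstar) sstar :=
    DifferentiableAt.hasFDerivAt (by fun_prop)
  have hB : HasFDerivAt (fun θ' => F (sstar, θ')) (fderiv ℝ (fun θ' => F (sstar, θ')) θ) θ :=
    DifferentiableAt.hasFDerivAt (by fun_prop)
  have hit : ∀ n, (fun v => F (v, θ))^[n] sstar = sstar := fun n =>
    Function.iterate_fixed (f := fun v => F (v, θ)) hfix n
  have hAn : ∀ n, HasFDerivAt ((fun v => F (v, θ))^[n])
      ((fderiv ℝ (fun u => F (u, θ)) sstar) ^ n) sstar := fun n => hA.iterate hfix n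
  have key : ∀ n, gradient (fun u => ℓ ((fun v => F (v, θ))^[n] u)) sstar =
      ((ContinuousLinearMap.adjoint (fderiv ℝ (fun u => F (u, θ)) sstar)) ^ n)
        (gradient ℓ sstar) := fun n => by
    rw [gradient_comp_aux (hit n) (hld _) (hAn n), ← ContinuousLinearMap.star_eq_adjoint,
      ← ContinuousLinearMap.star_eq_adjoint, star_pow]
  rw [hsT]
  refine ⟨key t, ?_⟩
  rw [← key (t - 1)]
  exact gradient_comp_aux (l := fun u => ℓ ((fun v => F (v, θ))^[t - 1] u)) hfix
    ((hld _).comp sstar (hAn (t - 1)).differentiableAt) hB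
end

section
/- Lemma 1 (EP neural-update recurrence, general transition function): For every t ≥ 0 the limit Δ_s^EP(t) := lim_{β→0} Δ_s^EP(β,t) exists, and these limits satisfy Δ_s^EP(0) = −∇ℓ(s_*) and, for all t ≥ 0, Δ_s^EP(t+1) = D_s F(s_*, θ) · Δ_s^EP(t), where D_s F(s_*,θ) is the derivative of F(·,θ) at s_*. -/
open Filter Topology

/-- Lemma 1 (EP neural-update recurrence, general transition function). -/
theorem ep_neural_update_recurrence
    {E : Type*} [NormedAddCommGroup E] [InnerProductSpace ℝ E] [FiniteDimensional ℝ E]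
    {Θ : Type*} [NormedAddCommGroup Θ] [InnerProductSpace ℝ Θ] [FiniteDimensional ℝ Θ]
    (F : E × Θ → E) (ℓ : E → ℝ)
    (hF : ContDiff ℝ 2 F) (hℓ : ContDiff ℝ 2 ℓ)
    (θ : Θ) (sstar : E) (hfix : sstar = F (sstar, θ))
    (sβ : ℝ → ℕ → E)
    (hsβ0 : ∀ β : ℝ, sβ β 0 = sstar)
    (hsβrec : ∀ β : ℝ, 0 < β → ∀ t, sβ β (t + 1) = F (sβ β t, θ) - β • gradient ℓ (sβ β t)) :
    ∃ Δ : ℕ → E,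
      (∀ t, Filter.Tendsto (fun β : ℝ => β⁻¹ • (sβ β (t + 1) - sβ β t)) (𝓝[>] (0 : ℝ))
        (𝓝 (Δ t))) ∧
      Δ 0 = -gradient ℓ sstar ∧
      ∀ t, Δ (t + 1) = fderiv ℝ (fun u => F (u, θ)) sstar (Δ t) := by
  set g : E → E := gradient ℓ with hg
  set A := fderiv ℝ (fun u => F (u, θ)) sstar with hA
  have hAd : HasFDerivAt (fun u => F (u, θ)) A sstar := by
    have h2 : ContDiff ℝ 2 (fun u => F (u, θ)) := hF.comp (contDiff_id.prodMk contDiff_const)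
    exact ((h2.differentiable (by norm_num)) sstar).hasFDerivAt
  have hgd : Differentiable ℝ g := by
    have h1 : ContDiff ℝ 1 (fderiv ℝ ℓ) := hℓ.fderiv_right (by norm_num)
    have h2 : Differentiable ℝ (fderiv ℝ ℓ) := h1.differentiable (by norm_num)
    intro x
    exact ((InnerProductSpace.toDual ℝ E).symm.toContinuousLinearEquiv.differentiableAt).comp x
      (h2 x)
  let v : ℕ → E := fun t => Nat.rec 0 (fun _ w => A w - g sstar) t
  let S : ℕ → ℝ → E := fun t β => Nat.rec sstar (fun _ w => F (w, θ) - β • g w) t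
  have hv : ∀ t, v (t + 1) = A (v t) - g sstar := fun t => rfl
  have hS : ∀ t β, S (t + 1) β = F (S t β, θ) - β • g (S t β) := fun t β => rfl
  have hS0 : ∀ t, S t 0 = sstar := by
    intro t
    induction t with
    | zero => rfl
    | succ t ih => rw [hS, ih, zero_smul, sub_zero, ← hfix]
  have hSe : ∀ t β, 0 < β → sβ β t = S t β := by
    intro t β hβ
    induction t with
    | zero => exact hsβ0 β
    | succ t ih => rw [hS, hsβrec β hβ, ih]
  have hd : ∀ t, HasDerivAt (S t) (v t) 0 := by
    intro t
    induction t with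
    | zero => exact hasDerivAt_const (0 : ℝ) sstar
    | succ t ih =>
      have hF1 : HasDerivAt (fun β => F (S t β, θ)) (A (v t)) 0 := by
        have h := hAd
        rw [← hS0 t] at h
        exact h.comp_hasDerivAt (0 : ℝ) ih
      have hg1 : HasDerivAt (fun β => g (S t β)) (fderiv ℝ g (S t 0) (v t)) 0 :=
        (hgd (S t 0)).hasFDerivAt.comp_hasDerivAt (0 : ℝ) ih
      have h3 := hF1.sub ((hasDerivAt_id (0 : ℝ)).smul hg1)
      have he : v (t + 1) = A (v t) - ((id (0 : ℝ)) • fderiv ℝ g (S t 0) (v t)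
          + (1 : ℝ) • g (S t 0)) := by
        rw [hv, hS0]; simp
      rw [he]
      exact h3
  refine ⟨fun t => v (t + 1) - v t, ?_, ?_, ?_⟩
  · intro t
    have h := ((hd (t + 1)).sub (hd t)).tendsto_slope_zero_right
    refine h.congr' ?_
    filter_upwards [self_mem_nhdsWithin] with β hβ
    rw [hSe _ β hβ, hSe _ β hβ]
    simp [hS0]
  · simp [v]
  · intro t
    simp only [hv, map_sub]
    abel
end

section
/- Lemma 1 (EP weight-update recurrence, general transition function): For every t ≥ 1, the limit Δ_θ^EP(t) := lim_{β→0} (1/β)(D_θ F(s_{t−1}^β, θ))^*(s_t^β − s_{t−1}^β) exists and satisfies Δ_θ^EP(t) = (D_θ F(s_*, θ))^* · Δ_s^EP(t−1), where Δ_s^EP(t−1) = lim_{β→0} (s_t^β − s_{t−1}^β)/β, D_θ F is the partial derivative of F in its second argument, and ^* denotes the adjoint. -/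
open Filter Topology

/-- The second-phase trajectory, defined for all real β. -/
noncomputable def epTraj {E : Type*} [AddCommGroup E] [Module ℝ E]
    (G H : E → E) (s : E) : ℕ → ℝ → E
  | 0, _ => s
  | n + 1, β => G (epTraj G H s n β) - β • H (epTraj G H s n β)

/-- Lemma 1 (EP weight-update recurrence, general transition function). -/
theorem ep_weight_update_recurrence
    {E : Type*} [NormedAddCommGroup E] [InnerProductSpace ℝ E] [FiniteDimensional ℝ E]
    {Θ : Type*} [NormedAddCommGroup Θ] [InnerProductSpace ℝ Θ] [FiniteDimensional ℝ Θ]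
    (F : E × Θ → E) (ℓ : E → ℝ)
    (hF : ContDiff ℝ 2 F) (hℓ : ContDiff ℝ 2 ℓ)
    (θ : Θ) (sstar : E) (hfix : sstar = F (sstar, θ))
    (sβ : ℝ → ℕ → E)
    (hsβ0 : ∀ β : ℝ, sβ β 0 = sstar)
    (hsβrec : ∀ β : ℝ, 0 < β → ∀ t, sβ β (t + 1) = F (sβ β t, θ) - β • gradient ℓ (sβ β t))
    (t : ℕ) (ht : 1 ≤ t) :
    ∃ Δs : E,
      Filter.Tendsto (fun β : ℝ => β⁻¹ • (sβ β t - sβ β (t - 1))) (𝓝[>] (0 : ℝ)) (𝓝 Δs) ∧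
      Filter.Tendsto
        (fun β : ℝ => β⁻¹ •
          (ContinuousLinearMap.adjoint (fderiv ℝ (fun θ' => F (sβ β (t - 1), θ')) θ))
            (sβ β t - sβ β (t - 1)))
        (𝓝[>] (0 : ℝ))
        (𝓝 ((ContinuousLinearMap.adjoint (fderiv ℝ (fun θ' => F (sstar, θ')) θ)) Δs)) := by
  have hgrad : ContDiff ℝ 1 (gradient ℓ) := by
    have h1 : ContDiff ℝ 1 (fderiv ℝ ℓ) := hℓ.fderiv_right (by norm_num)
    exact (InnerProductSpace.toDual ℝ E).symm.toContinuousLinearEquiv.contDiff.comp h1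
  have hG : ContDiff ℝ 1 (fun s => F (s, θ)) :=
    (hF.of_le (by norm_num)).comp (contDiff_id.prodMk contDiff_const)
  set g := epTraj (fun s => F (s, θ)) (gradient ℓ) sstar with hg
  have hgc : ∀ n, ContDiff ℝ 1 (g n) := by
    intro n
    induction n with
    | zero => exact contDiff_const
    | succ n ih => exact (hG.comp ih).sub (contDiff_id.smul (hgrad.comp ih))
  have hg0 : ∀ n, g n 0 = sstar := by
    intro n
    induction n with
    | zero => rfl
    | succ n ih =>
      change F (g n 0, θ) - (0 : ℝ) • gradient ℓ (g n 0) = sstar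
      rw [ih, zero_smul, sub_zero, ← hfix]
  have hgs : ∀ n (β : ℝ), 0 < β → sβ β n = g n β := by
    intro n β hβ
    induction n with
    | zero => exact hsβ0 β
    | succ n ih => rw [hsβrec β hβ, ih]; rfl
  have hd : HasDerivAt (fun β => g t β - g (t - 1) β)
      (deriv (fun β => g t β - g (t - 1) β) 0) 0 :=
    ((((hgc t).sub (hgc (t - 1))).differentiable (by norm_num)) 0).hasDerivAt
  set D := deriv (fun β => g t β - g (t - 1) β) 0 with hD
  have hlim : Tendsto (fun β : ℝ => β⁻¹ • (sβ β t - sβ β (t - 1))) (𝓝[>] (0 : ℝ)) (𝓝 D) := by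
    have h := hd.tendsto_slope_zero_right
    refine h.congr' ?_
    filter_upwards [self_mem_nhdsWithin] with β hβ
    rw [hgs t β hβ, hgs (t - 1) β hβ, zero_add, hg0, hg0, sub_self, sub_zero]
  refine ⟨D, hlim, ?_⟩
  have hpart : ∀ s, fderiv ℝ (fun θ' => F (s, θ')) θ
      = (fderiv ℝ F (s, θ)).comp (ContinuousLinearMap.inr ℝ E Θ) := by
    intro s
    have h1 : HasFDerivAt F (fderiv ℝ F (s, θ)) (s, θ) :=
      (hF.differentiable (by norm_num) (s, θ)).hasFDerivAt
    exact (h1.comp θ (hasFDerivAt_prodMk_right s θ)).fderiv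
  have hcont : Continuous (fun s => ContinuousLinearMap.adjoint
      (fderiv ℝ (fun θ' => F (s, θ')) θ)) := by
    refine (ContinuousLinearMap.adjoint (𝕜 := ℝ) (E := Θ) (F := E)).continuous.comp ?_
    simp only [hpart]
    have h1 : Continuous (fderiv ℝ F) := hF.continuous_fderiv (by norm_num)
    exact (h1.comp (by fun_prop : Continuous fun s : E => (s, θ))).clm_comp continuous_const
  have hst : Tendsto (fun β : ℝ => sβ β (t - 1)) (𝓝[>] (0 : ℝ)) (𝓝 sstar) := by
    have h := ((hgc (t - 1)).continuous.tendsto 0).mono_left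
      (nhdsWithin_le_nhds (s := Set.Ioi (0 : ℝ)))
    rw [hg0] at h
    refine h.congr' ?_
    filter_upwards [self_mem_nhdsWithin] with β hβ
    exact (hgs (t - 1) β hβ).symm
  have hA := (hcont.tendsto sstar).comp hst
  have hap := (isBoundedBilinearMap_apply (𝕜 := ℝ) (E := E) (F := Θ)).continuous.tendsto
    (ContinuousLinearMap.adjoint (fderiv ℝ (fun θ' => F (sstar, θ')) θ), D)
  refine (hap.comp (hA.prodMk_nhds hlim)).congr fun β => ?_
  simp only [Function.comp, map_smul]
end

section
/- Closed form for the β-derivative of the second phase: the derivatives d_t := (∂/∂β) s_t^β |_{β=0} are given explicitly by d_t = −∑_{k=0}^{t−1} (D_s F(s_*, θ))^k · ∇ℓ(s_*) for every t ≥ 0, where (D_s F(s_*,θ))^k denotes the k-fold composition of the derivative of F(·,θ) at s_*. -/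
open Filter Topology

/-- Closed form for the β-derivative of the second-phase trajectory at β = 0. -/
theorem second_phase_beta_derivative_closed_form
    {E : Type*} [NormedAddCommGroup E] [InnerProductSpace ℝ E] [FiniteDimensional ℝ E]
    {Θ : Type*} [NormedAddCommGroup Θ] [InnerProductSpace ℝ Θ] [FiniteDimensional ℝ Θ]
    (F : E × Θ → E) (ℓ : E → ℝ)
    (hF : ContDiff ℝ 2 F) (hℓ : ContDiff ℝ 2 ℓ)
    (θ : Θ) (sstar : E) (hfix : sstar = F (sstar, θ))
    (sβ : ℝ → ℕ → E)
    (hsβ0 : ∀ β : ℝ, sβ β 0 = sstar)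
    (hsβrec : ∀ β : ℝ, ∀ t, sβ β (t + 1) = F (sβ β t, θ) - β • gradient ℓ (sβ β t)) :
    ∀ t, DifferentiableAt ℝ (fun β : ℝ => sβ β t) 0 ∧
      deriv (fun β : ℝ => sβ β t) 0 =
        -∑ k ∈ Finset.range t,
          ((fderiv ℝ (fun u => F (u, θ)) sstar) ^ k) (gradient ℓ sstar) := by
  have hgrad : Differentiable ℝ (gradient ℓ) := by
    have h1 : Differentiable ℝ (fderiv ℝ ℓ) :=
      (hℓ.fderiv_right (m := 1) (by norm_num)).differentiable (by norm_num)
    intro x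
    exact (InnerProductSpace.toDual ℝ E).symm.toContinuousLinearEquiv.differentiableAt.comp x (h1 x)
  have hG : Differentiable ℝ (fun u => F (u, θ)) := by
    have h2 : Differentiable ℝ F := hF.differentiable (by norm_num)
    fun_prop
  have h0 : ∀ t, sβ 0 t = sstar := by
    intro t
    induction t with
    | zero => exact hsβ0 0
    | succ t ih => rw [hsβrec, ih, zero_smul, sub_zero, ← hfix]
  have key : ∀ t, HasDerivAt (fun β : ℝ => sβ β t)
      (-∑ k ∈ Finset.range t,
          ((fderiv ℝ (fun u => F (u, θ)) sstar) ^ k) (gradient ℓ sstar)) 0 := by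
    intro t
    induction t with
    | zero =>
      simp only [hsβ0, Finset.range_zero, Finset.sum_empty, neg_zero]
      exact hasDerivAt_const _ _
    | succ t ih =>
      have e : (fun β : ℝ => sβ β (t + 1)) =
          fun β => F (sβ β t, θ) - β • gradient ℓ (sβ β t) := by
        funext β
        exact hsβrec β t
      rw [e]
      have hA : HasFDerivAt (fun u => F (u, θ)) (fderiv ℝ (fun u => F (u, θ)) sstar) (sβ 0 t) := by
        rw [h0]
        exact (hG sstar).hasFDerivAt
      have hB := hA.comp_hasDerivAt (0 : ℝ) ih
      have hg : HasFDerivAt (gradient ℓ) (fderiv ℝ (gradient ℓ) (sβ 0 t)) (sβ 0 t) :=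
        (hgrad _).hasFDerivAt
      have hC := (hasDerivAt_id (0 : ℝ)).smul (hg.comp_hasDerivAt (0 : ℝ) ih)
      have hD := hB.sub hC
      refine HasDerivAt.congr_deriv hD ?_
      rw [Finset.sum_range_succ']
      simp [h0, pow_succ', map_sum]
      abel
  exact fun t => ⟨(key t).differentiableAt, (key t).deriv⟩
end

section
/- Equilibrium Propagation gradient formula (discrete time): Assume F(s,θ) = ∇_s Φ(s,θ) with Φ C³, let s_* satisfy s_* = F(s_*, θ₀), and assume Id_E − D_s F(s_*, θ₀) is invertible. Then there are a C¹ branch β ↦ s_*^β of fixed points of s ↦ F(s,θ₀) − β∇ℓ(s) with s_*^0 = s_*, defined near β = 0, and a C¹ branch θ ↦ s_*(θ) of fixed points of F(·,θ) with s_*(θ₀) = s_*, defined near θ₀; and with L*(θ) := ℓ(s_*(θ)) one has lim_{β→0} (1/β)(∇_θΦ(s_*^β, θ₀) − ∇_θΦ(s_*, θ₀)) = −∇L*(θ₀). -/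
open Filter Topology

/-- The inverse Riesz map as a real-linear continuous map. -/
noncomputable def epRiesz (E : Type*) [NormedAddCommGroup E] [InnerProductSpace ℝ E]
    [CompleteSpace E] : StrongDual ℝ E →L[ℝ] E :=
  LinearMap.mkContinuous
    { toFun := fun f => (InnerProductSpace.toDual ℝ E).symm f
      map_add' := fun f g => map_add _ f g
      map_smul' := fun c f => by simp } 1 (fun f => by simp)

theorem epRiesz_fderiv {E : Type*} [NormedAddCommGroup E] [InnerProductSpace ℝ E]
    [CompleteSpace E] (f : E → ℝ) (x : E) : epRiesz E (fderiv ℝ f x) = gradient f x := rfl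

theorem inner_epRiesz {E : Type*} [NormedAddCommGroup E] [InnerProductSpace ℝ E]
    [CompleteSpace E] (f : StrongDual ℝ E) (x : E) : inner ℝ (epRiesz E f) x = f x := by
  simp [epRiesz]

/-- Implicit function theorem for fixed points. -/
theorem ep_implicit {X E : Type*} [NormedAddCommGroup X] [NormedSpace ℝ X] [CompleteSpace X]
    [NormedAddCommGroup E] [NormedSpace ℝ E] [CompleteSpace E]
    (G : X × E → E) (hG : ContDiff ℝ 1 G) (x₀ : X) (e₀ : E) (h0 : e₀ = G (x₀, e₀))
    (hinv : IsUnit ((1 : E →L[ℝ] E) - fderiv ℝ (fun u => G (x₀, u)) e₀)) :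
    ∃ (ψ : X → E) (U : Set X), U ∈ 𝓝 x₀ ∧ ContDiffOn ℝ 1 ψ U ∧ ψ x₀ = e₀ ∧
      (∀ x ∈ U, ψ x = G (x, ψ x)) ∧ DifferentiableAt ℝ ψ x₀ ∧
      ∀ w, fderiv ℝ ψ x₀ w = fderiv ℝ G (x₀, e₀) (w, fderiv ℝ ψ x₀ w) := by
  let H : X × E → E := fun p => p.2 - G p
  have hH : ContDiff ℝ 1 H := contDiff_snd.sub hG
  have hGd : HasFDerivAt G (fderiv ℝ G (x₀, e₀)) (x₀, e₀) :=
    (hG.differentiable one_ne_zero _).hasFDerivAt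
  have hHd : HasFDerivAt H (ContinuousLinearMap.snd ℝ X E - fderiv ℝ G (x₀, e₀)) (x₀, e₀) :=
    hasFDerivAt_snd.sub hGd
  have hpart : HasFDerivAt (fun u => G (x₀, u))
      (fderiv ℝ G (x₀, e₀) ∘L ContinuousLinearMap.inr ℝ X E) e₀ :=
    HasFDerivAt.comp e₀ (f := fun u : E => (x₀, u)) hGd (hasFDerivAt_prodMk_right x₀ e₀)
  have hi : (fderiv ℝ H (x₀, e₀) ∘L ContinuousLinearMap.inr ℝ X E).IsInvertible := by
    rw [hHd.fderiv]
    rw [hpart.fderiv] at hinv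
    obtain ⟨u, hu⟩ := hinv
    refine ⟨ContinuousLinearEquiv.ofUnit u, ?_⟩
    ext v
    have := congrArg (fun L : E →L[ℝ] E => L v) hu
    change (u : E →L[ℝ] E) v = _
    simpa using this
  have hc : ContDiffAt ℝ 1 H (x₀, e₀) := hH.contDiffAt
  let ψ := hc.implicitFunction one_ne_zero hi
  have h1 : ψ x₀ = e₀ := hc.implicitFunction_apply_self one_ne_zero hi
  have h2 : ∀ᶠ x in 𝓝 x₀, H (x, ψ x) = H (x₀, e₀) :=
    hc.eventually_apply_implicitFunction one_ne_zero hi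
  have h3 : ContDiffAt ℝ 1 ψ x₀ := hc.contDiffAt_implicitFunction one_ne_zero hi
  have h4 : ∀ᶠ x in 𝓝 x₀, ψ x = G (x, ψ x) := by
    filter_upwards [h2] with x hx
    have : H (x₀, e₀) = 0 := by simp only [H]; rw [← h0, sub_self]
    rw [this] at hx
    exact sub_eq_zero.mp hx
  have hd : DifferentiableAt ℝ ψ x₀ := h3.differentiableAt one_ne_zero
  obtain ⟨V, hV, hV'⟩ := h3.contDiffOn (m := 1) le_rfl (by simp)
  refine ⟨ψ, V ∩ {x | ψ x = G (x, ψ x)}, inter_mem hV h4,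
    hV'.mono Set.inter_subset_left, h1, fun x hx => hx.2, hd, ?_⟩
  intro w
  have hcomp : HasFDerivAt (fun x => G (x, ψ x))
      (fderiv ℝ G (x₀, e₀) ∘L (ContinuousLinearMap.id ℝ X).prod (fderiv ℝ ψ x₀)) x₀ :=
    HasFDerivAt.comp x₀ (f := fun x => (x, ψ x)) (by rw [h1]; exact hGd)
      ((hasFDerivAt_id x₀).prodMk hd.hasFDerivAt)
  have := (hcomp.congr_of_eventuallyEq h4).fderiv
  exact congrArg (fun L : X →L[ℝ] E => L w) this

/-- Equilibrium Propagation gradient formula (discrete time). -/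
theorem ep_gradient_formula
    {E : Type*} [NormedAddCommGroup E] [InnerProductSpace ℝ E] [FiniteDimensional ℝ E]
    {Θ : Type*} [NormedAddCommGroup Θ] [InnerProductSpace ℝ Θ] [FiniteDimensional ℝ Θ]
    (F : E × Θ → E) (ℓ : E → ℝ) (Φ : E × Θ → ℝ)
    (hF : ContDiff ℝ 2 F) (hℓ : ContDiff ℝ 2 ℓ) (hΦ : ContDiff ℝ 3 Φ)
    (hFΦ : ∀ (u : E) (θ : Θ), F (u, θ) = gradient (fun v => Φ (v, θ)) u)
    (θ₀ : Θ) (sstar : E) (hfix : sstar = F (sstar, θ₀))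
    (hinv : IsUnit ((1 : E →L[ℝ] E) - fderiv ℝ (fun u => F (u, θ₀)) sstar)) :
    ∃ (sb : ℝ → E) (st : Θ → E) (U : Set ℝ) (V : Set Θ),
      U ∈ 𝓝 (0 : ℝ) ∧ V ∈ 𝓝 θ₀ ∧
      ContDiffOn ℝ 1 sb U ∧ ContDiffOn ℝ 1 st V ∧
      sb 0 = sstar ∧ st θ₀ = sstar ∧
      (∀ β ∈ U, sb β = F (sb β, θ₀) - β • gradient ℓ (sb β)) ∧
      (∀ θ ∈ V, st θ = F (st θ, θ)) ∧
      DifferentiableAt ℝ (fun θ => ℓ (st θ)) θ₀ ∧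
      Filter.Tendsto
        (fun β : ℝ => β⁻¹ •
          (gradient (fun θ' => Φ (sb β, θ')) θ₀ - gradient (fun θ' => Φ (sstar, θ')) θ₀))
        (𝓝[≠] (0 : ℝ))
        (𝓝 (-(gradient (fun θ => ℓ (st θ)) θ₀))) := by
  have hgradℓ : ContDiff ℝ 1 (gradient ℓ) :=
    (epRiesz E).contDiff.comp (hℓ.fderiv_right (m := 1) (by norm_num))
  have hF1 : ContDiff ℝ 1 F := hF.of_le (by norm_num)
  have hFd : HasFDerivAt F (fderiv ℝ F (sstar, θ₀)) (sstar, θ₀) :=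
    (hF1.differentiable one_ne_zero _).hasFDerivAt
  -- first branch
  let G : ℝ × E → E := fun q => F (q.2, θ₀) - q.1 • gradient ℓ q.2
  have hG : ContDiff ℝ 1 G :=
    (hF1.comp (contDiff_snd.prodMk contDiff_const)).sub
      (contDiff_fst.smul (hgradℓ.comp contDiff_snd))
  obtain ⟨sb, U, hU, hsbC, hsb0, hsbfix, hsbd, hsbeq⟩ := ep_implicit G hG 0 sstar
    (by simpa [G] using hfix) (by simpa [G] using hinv)
  -- second branch
  let K : Θ × E → E := fun q => F (q.2, q.1)
  have hK : ContDiff ℝ 1 K := hF1.comp (contDiff_snd.prodMk contDiff_fst)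
  obtain ⟨st, V, hV, hstC, hst0, hstfix, hstd, hsteq⟩ := ep_implicit K hK θ₀ sstar hfix hinv
  have hℓd : HasFDerivAt ℓ (fderiv ℝ ℓ sstar) sstar :=
    (hℓ.differentiable two_ne_zero _).hasFDerivAt
  have hLd : HasFDerivAt (fun θ => ℓ (st θ)) (fderiv ℝ ℓ sstar ∘L fderiv ℝ st θ₀) θ₀ :=
    HasFDerivAt.comp θ₀ (f := st) (by rw [hst0]; exact hℓd) hstd.hasFDerivAt
  refine ⟨sb, st, U, V, hU, hV, hsbC, hstC, hsb0, hst0, hsbfix, hstfix,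
    hLd.differentiableAt, ?_⟩
  -- derivative identities
  set D := fderiv ℝ F (sstar, θ₀) with hD
  set p : E := fderiv ℝ sb 0 1 with hp
  have hsbD : HasDerivAt sb p 0 := by
    simpa [hp] using hsbd.hasFDerivAt.hasDerivAt
  have hpeq : p = D (p, 0) - gradient ℓ sstar := by
    have hfd : HasFDerivAt G
        (D ∘L ((ContinuousLinearMap.snd ℝ ℝ E).prod 0) -
          ((0 : ℝ) • (fderiv ℝ (gradient ℓ) sstar ∘L ContinuousLinearMap.snd ℝ ℝ E) +
            (ContinuousLinearMap.fst ℝ ℝ E).smulRight (gradient ℓ sstar))) ((0 : ℝ), sstar) := by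
      refine HasFDerivAt.sub ?_ ?_
      · exact HasFDerivAt.comp ((0 : ℝ), sstar) (f := fun q : ℝ × E => (q.2, θ₀)) hFd
          (hasFDerivAt_snd.prodMk (hasFDerivAt_const _ _))
      · exact HasFDerivAt.smul (c := fun q : ℝ × E => q.1) hasFDerivAt_fst
          (HasFDerivAt.comp ((0 : ℝ), sstar) (f := fun q : ℝ × E => q.2)
            (hgradℓ.differentiable one_ne_zero _).hasFDerivAt hasFDerivAt_snd)
    have := hsbeq 1
    rw [hfd.fderiv, ← hp] at this
    simpa only [_root_.sub_apply, ContinuousLinearMap.comp_apply,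
      ContinuousLinearMap.prod_apply, _root_.add_apply, zero_smul,
      _root_.zero_apply, zero_add, ContinuousLinearMap.smulRight_apply,
      ContinuousLinearMap.coe_fst', ContinuousLinearMap.coe_snd', one_smul] using this
  have hTeq : ∀ w, fderiv ℝ st θ₀ w = D (fderiv ℝ st θ₀ w, w) := by
    intro w
    have hfd : HasFDerivAt K
        (D ∘L ((ContinuousLinearMap.snd ℝ Θ E).prod (ContinuousLinearMap.fst ℝ Θ E)))
        (θ₀, sstar) :=
      HasFDerivAt.comp (θ₀, sstar) (f := fun q : Θ × E => (q.2, q.1)) hFd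
          (hasFDerivAt_snd.prodMk hasFDerivAt_fst)
    have := hsteq w
    rw [hfd.fderiv] at this
    simpa using this
  -- second derivative of Φ
  have hΦ1 : ContDiff ℝ 2 (fderiv ℝ Φ) := hΦ.fderiv_right (by norm_num)
  have hΦd : ∀ q, HasFDerivAt Φ (fderiv ℝ Φ q) q := fun q =>
    (hΦ.differentiable (by norm_num) q).hasFDerivAt
  set B := fderiv ℝ (fderiv ℝ Φ) (sstar, θ₀) with hB
  have hBd : HasFDerivAt (fderiv ℝ Φ) B (sstar, θ₀) :=
    (hΦ1.differentiable two_ne_zero _).hasFDerivAt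
  have hsymm : ∀ v w, B v w = B w v :=
    (hΦ.contDiffAt (x := (sstar, θ₀))).isSymmSndFDerivAt (by simp; norm_num)
  have hFi : ∀ q v, inner ℝ (F q) v = fderiv ℝ Φ q (v, 0) := by
    rintro ⟨u, θ⟩ v
    have h1 : HasFDerivAt (fun v => Φ (v, θ))
        (fderiv ℝ Φ (u, θ) ∘L ContinuousLinearMap.inl ℝ E Θ) u :=
      HasFDerivAt.comp u (f := fun v : E => (v, θ)) (hΦd (u, θ)) (hasFDerivAt_prodMk_left u θ)
    rw [hFΦ, ← epRiesz_fderiv, inner_epRiesz, h1.fderiv]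
    simp
  have hDB : ∀ w v, inner ℝ (D w) v = B w (v, 0) := by
    intro w v
    have h1 : HasFDerivAt (fun q => inner ℝ v (F q)) ((innerSL ℝ v) ∘L D) (sstar, θ₀) :=
      (innerSL ℝ v).hasFDerivAt.comp _ hFd
    have h2 : HasFDerivAt (fun q => fderiv ℝ Φ q (v, 0))
        ((ContinuousLinearMap.apply ℝ ℝ ((v, 0) : E × Θ)) ∘L B) (sstar, θ₀) :=
      (ContinuousLinearMap.apply ℝ ℝ ((v, 0) : E × Θ)).hasFDerivAt.comp _ hBd
    have h3 : (fun q => inner ℝ v (F q)) = fun q => fderiv ℝ Φ q (v, 0) := by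
      funext q
      rw [real_inner_comm, hFi]
    rw [h3] at h1
    have := congrArg (fun L : E × Θ →L[ℝ] ℝ => L w) (h1.unique h2)
    rw [real_inner_comm]
    simpa using this
  -- gradient in θ
  have hgθ : ∀ u, gradient (fun θ' => Φ (u, θ')) θ₀ =
      epRiesz Θ (fderiv ℝ Φ (u, θ₀) ∘L ContinuousLinearMap.inr ℝ E Θ) := by
    intro u
    have h1 : HasFDerivAt (fun θ' => Φ (u, θ'))
        (fderiv ℝ Φ (u, θ₀) ∘L ContinuousLinearMap.inr ℝ E Θ) θ₀ :=
      HasFDerivAt.comp θ₀ (f := fun θ' : Θ => (u, θ')) (hΦd (u, θ₀))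
        (hasFDerivAt_prodMk_right u θ₀)
    rw [← epRiesz_fderiv, h1.fderiv]
  obtain ⟨R, hR', hRi⟩ : ∃ R : StrongDual ℝ (E × Θ) →L[ℝ] Θ,
      (∀ f, R f = epRiesz Θ (f ∘L ContinuousLinearMap.inr ℝ E Θ)) ∧
      ∀ f w, inner ℝ (R f) w = f (0, w) := by
    refine ⟨epRiesz Θ ∘L
      ((ContinuousLinearMap.compL ℝ Θ (E × Θ) ℝ).flip (ContinuousLinearMap.inr ℝ E Θ)),
      fun f => rfl, fun f w => ?_⟩
    rw [ContinuousLinearMap.comp_apply, inner_epRiesz]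
    simp
  have hR : ∀ u, gradient (fun θ' => Φ (u, θ')) θ₀ = R (fderiv ℝ Φ (u, θ₀)) := by
    intro u
    rw [hgθ, hR']
  have hlim : HasDerivAt (fun β => R (fderiv ℝ Φ (sb β, θ₀))) (R (B (p, 0))) 0 := by
    have h1 : HasDerivAt (fun β => (sb β, θ₀)) (p, (0 : Θ)) 0 :=
      hsbD.prodMk (hasDerivAt_const _ _)
    have h2 : HasDerivAt (fun β => fderiv ℝ Φ (sb β, θ₀)) (B (p, 0)) 0 :=
      HasFDerivAt.comp_hasDerivAt (0 : ℝ) (l := fderiv ℝ Φ) (f := fun β => (sb β, θ₀))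
        (by rw [hsb0]; exact hBd) h1
    have h3 : HasFDerivAt (fun f => R f) R (fderiv ℝ Φ (sb 0, θ₀)) := R.hasFDerivAt
    exact HasFDerivAt.comp_hasDerivAt (0 : ℝ) (f := fun β => fderiv ℝ Φ (sb β, θ₀)) h3 h2
  have hval : R (B (p, 0)) = -(gradient (fun θ => ℓ (st θ)) θ₀) := by
    refine ext_inner_right ℝ fun w => ?_
    have e1 : inner ℝ (R (B (p, 0))) w = B (p, 0) (0, w) := hRi _ _
    rw [e1, inner_neg_left, ← epRiesz_fderiv, inner_epRiesz, hLd.fderiv,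
      ContinuousLinearMap.comp_apply]
    set T := fderiv ℝ st θ₀ w with hT
    have e2 : fderiv ℝ ℓ sstar T = inner ℝ (gradient ℓ sstar) T := by
      rw [← epRiesz_fderiv, inner_epRiesz]
    have e3 : gradient ℓ sstar = D (p, 0) - p := by
      rw [eq_sub_iff_add_eq, add_comm, ← eq_sub_iff_add_eq]; exact hpeq
    have e4 : inner ℝ p T = B (T, w) (p, 0) := by
      rw [← hDB, real_inner_comm, ← hTeq w]
    have e5 : B (p, 0) (T, w) = B (p, 0) (T, 0) + B (p, 0) (0, w) := by
      rw [← map_add]; simp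
    rw [e2, e3, inner_sub_left, hDB, e4, hsymm (T, w), e5]
    ring
  rw [← hval]
  have := hasDerivAt_iff_tendsto_slope_zero.mp hlim
  simpa only [hR, zero_add, hsb0] using this
end

section
/- Existence of a primitive function for a transition function with symmetric Jacobian: Let E be a finite-dimensional real inner-product space and F : E → E a C¹ map whose derivative is symmetric at every point, i.e. ⟨(DF(s))u, v⟩ = ⟨(DF(s))v, u⟩ for all s, u, v ∈ E. Then there exists a differentiable function Φ : E → ℝ such that ∇Φ(s) = F(s) for all s ∈ E. -/
open Filter Topology RealInnerProductSpace

/-- Existence of a primitive function for a transition function with symmetric Jacobian. -/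
theorem exists_primitive_of_symmetric_jacobian
    {E : Type*} [NormedAddCommGroup E] [InnerProductSpace ℝ E] [FiniteDimensional ℝ E]
    (F : E → E) (hF : ContDiff ℝ 1 F)
    (hsymm : ∀ s u v : E, ⟪(fderiv ℝ F s) u, v⟫ = ⟪(fderiv ℝ F s) v, u⟫) :
    ∃ Φ : E → ℝ, Differentiable ℝ Φ ∧ ∀ s, gradient Φ s = F s := by
  have hd : ∀ a, HasFDerivAt (fun x => innerSL ℝ (F x)) ((innerSL ℝ).comp (fderiv ℝ F a)) a := by
    intro a
    exact (innerSL ℝ (E := E)).hasFDerivAt.comp a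
      ((hF.differentiable one_ne_zero) a).hasFDerivAt
  obtain ⟨Φ, hΦ⟩ := (convex_univ (𝕜 := ℝ) (E := E)).exists_forall_hasFDerivAt_of_fderiv_symmetric
    isOpen_univ (ω := fun x => innerSL ℝ (F x))
    (fun a _ => (hd a).differentiableAt.differentiableWithinAt)
    (fun a _ x y => by
      rw [(hd a).fderiv]
      exact hsymm a x y)
  refine ⟨Φ, fun a => (hΦ a trivial).differentiableAt, fun a => ?_⟩
  apply HasGradientAt.gradient
  rw [hasGradientAt_iff_hasFDerivAt]
  exact hΦ a trivial
end

section
/- Lemma 2, Eq. (lma2) (gradient of a pooled convolution with respect to the input is a transpose convolution): With Z = W*X and Φ(X) = ∑_{p} Y(p) · max_{i ∈ B(p)} (W*X)(i) for pairwise disjoint pooling windows B(p), if at X₀ the maximum over each window of W*X₀ is attained at a unique index, then Φ is differentiable at X₀ with ∂Φ/∂X(c,p,q) = ∑_{c' ∈ C_out} ∑_{r,s=1}^{F} W(c',c,r,s) · P^{-1}(Y)(c', p−(r−1), q−(s−1)), where terms whose index (c', p−(r−1), q−(s−1)) falls outside the convolution output index set are zero; equivalently ∇Φ(X₀) = W̃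 * P^{-1}(Y), the convolution of the zero-padded P^{-1}(Y) by the flipped kernel W̃(c,c',r,s) = W(c',c,F−r+1,F−s+1). -/
open Filter Topology

/-- The (valid, stride-1) 2D convolution `W * X` of a fixed filter `W` (indexed by output
channel, input channel and 0-based kernel offsets) with the input `X`, as a function of `X`. -/
noncomputable def convByInput {Cout Cin : Type*} [Fintype Cin] (Fsz D : ℕ) (hFD : Fsz ≤ D)
    (W : Cout → Cin → Fin Fsz → Fin Fsz → ℝ)
    (X : EuclideanSpace ℝ (Cin × Fin D × Fin D)) :
    Cout × Fin (D - Fsz + 1) × Fin (D - Fsz + 1) → ℝ :=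
  fun j => ∑ c : Cin, ∑ r : Fin Fsz, ∑ s : Fin Fsz,
    W j.1 c r s *
      X (c, ⟨(j.2.1 : ℕ) + (r : ℕ), by have h1 := j.2.1.isLt; have h2 := r.isLt; omega⟩,
            ⟨(j.2.2 : ℕ) + (s : ℕ), by have h1 := j.2.2.isLt; have h2 := s.isLt; omega⟩)

/-- The convolution at a fixed output index, as a continuous linear functional of the input. -/
noncomputable def convCLM {Cout Cin : Type*} [Fintype Cin] (Fsz D : ℕ) (hFD : Fsz ≤ D)
    (W : Cout → Cin → Fin Fsz → Fin Fsz → ℝ)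
    (j : Cout × Fin (D - Fsz + 1) × Fin (D - Fsz + 1)) :
    EuclideanSpace ℝ (Cin × Fin D × Fin D) →L[ℝ] ℝ :=
  LinearMap.toContinuousLinearMap
    { toFun := fun X => convByInput Fsz D hFD W X j
      map_add' := by
        intro X X'
        simp only [convByInput, PiLp.add_apply, mul_add, Finset.sum_add_distrib]
      map_smul' := by
        intro a X
        simp only [convByInput, PiLp.smul_apply, smul_eq_mul, Finset.mul_sum, RingHom.id_apply]
        refine Finset.sum_congr rfl fun c _ => Finset.sum_congr rfl fun r _ =>
          Finset.sum_congr rfl fun s _ => ?_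
        ring }

theorem convCLM_apply {Cout Cin : Type*} [Fintype Cin] (Fsz D : ℕ) (hFD : Fsz ≤ D)
    (W : Cout → Cin → Fin Fsz → Fin Fsz → ℝ)
    (j : Cout × Fin (D - Fsz + 1) × Fin (D - Fsz + 1))
    (X : EuclideanSpace ℝ (Cin × Fin D × Fin D)) :
    convCLM Fsz D hFD W j X = convByInput Fsz D hFD W X j := rfl

/-- Lemma 2, Eq. (lma2): the gradient of a pooled convolution with respect to the input is
the transpose convolution `W̃ * P⁻¹(Y)` of the (zero-padded) inverse pooling of `Y` by the
flipped kernel.  Here the inverse pooling `Pinv` is represented as a function on integer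
coordinates, equal to `Y p` at the (unique) argmax position of the window `B p` and `0`
everywhere else (in particular outside the convolution output index range). -/
theorem gradient_pooled_convolution_input
    {Cout Cin P : Type*} [Fintype Cout] [Fintype Cin] [Fintype P]
    (Fsz D : ℕ) (hFsz : 0 < Fsz) (hFD : Fsz ≤ D)
    (W : Cout → Cin → Fin Fsz → Fin Fsz → ℝ)
    (B : P → Finset (Cout × Fin (D - Fsz + 1) × Fin (D - Fsz + 1)))
    (hne : ∀ p, (B p).Nonempty)
    (hdisj : ∀ p q, p ≠ q → Disjoint (B p) (B q))
    (Y : P → ℝ)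
    (X₀ : EuclideanSpace ℝ (Cin × Fin D × Fin D))
    (m : P → Cout × Fin (D - Fsz + 1) × Fin (D - Fsz + 1))
    (hm : ∀ p, m p ∈ B p)
    (hmax : ∀ p, ∀ j ∈ B p, j ≠ m p →
      convByInput Fsz D hFD W X₀ j < convByInput Fsz D hFD W X₀ (m p))
    (Pinv : Cout → ℤ → ℤ → ℝ)
    (hPinv1 : ∀ p, Pinv (m p).1 (((m p).2.1 : ℕ) : ℤ) (((m p).2.2 : ℕ) : ℤ) = Y p)
    (hPinv0 : ∀ (c' : Cout) (x y : ℤ),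
      (∀ p, ¬((m p).1 = c' ∧ (((m p).2.1 : ℕ) : ℤ) = x ∧ (((m p).2.2 : ℕ) : ℤ) = y)) →
      Pinv c' x y = 0) :
    DifferentiableAt ℝ
      (fun X : EuclideanSpace ℝ (Cin × Fin D × Fin D) =>
        ∑ p, Y p * (B p).sup' (hne p) (convByInput Fsz D hFD W X)) X₀ ∧
    ∀ (c : Cin) (p q : Fin D),
      gradient
        (fun X : EuclideanSpace ℝ (Cin × Fin D × Fin D) =>
          ∑ p, Y p * (B p).sup' (hne p) (convByInput Fsz D hFD W X)) X₀ (c, p, q) =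
      ∑ c' : Cout, ∑ r : Fin Fsz, ∑ s : Fin Fsz,
        W c' c r s * Pinv c' (((p : ℕ) : ℤ) - ((r : ℕ) : ℤ)) (((q : ℕ) : ℤ) - ((s : ℕ) : ℤ)) := by
  classical
  have hev : (fun X : EuclideanSpace ℝ (Cin × Fin D × Fin D) =>
        ∑ p, Y p * (B p).sup' (hne p) (convByInput Fsz D hFD W X)) =ᶠ[𝓝 X₀]
      fun X => (∑ p, Y p • convCLM Fsz D hFD W (m p)) X := by
    have h1 : ∀ p, ∀ j ∈ B p, ∀ᶠ X in 𝓝 X₀,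
        convByInput Fsz D hFD W X j ≤ convByInput Fsz D hFD W X (m p) := by
      intro p j hj
      by_cases hjm : j = m p
      · subst hjm
        exact Eventually.of_forall fun X => le_rfl
      · have h := hmax p j hj hjm
        have hlt := ((convCLM Fsz D hFD W j).continuous.continuousAt (x := X₀)).eventually_lt
          ((convCLM Fsz D hFD W (m p)).continuous.continuousAt (x := X₀)) h
        exact hlt.mono fun X hX => le_of_lt hX
    have h2 : ∀ᶠ X in 𝓝 X₀, ∀ p, ∀ j ∈ B p,
        convByInput Fsz D hFD W X j ≤ convByInput Fsz D hFD W X (m p) := by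
      rw [eventually_all]
      intro p
      rw [Filter.eventually_all_finset]
      exact h1 p
    filter_upwards [h2] with X hX
    simp only [ContinuousLinearMap.sum_apply, ContinuousLinearMap.smul_apply, smul_eq_mul,
      convCLM_apply]
    refine Finset.sum_congr rfl fun p _ => ?_
    congr 1
    exact le_antisymm (Finset.sup'_le _ _ (hX p)) (Finset.le_sup' _ (hm p))
  have hF := ((∑ p, Y p • convCLM Fsz D hFD W (m p)).hasFDerivAt (x := X₀)).congr_of_eventuallyEq hev
  refine ⟨hF.differentiableAt, ?_⟩
  have hinj : ∀ p q, m p = m q → p = q := by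
    intro p q h
    by_contra hpq
    exact Finset.disjoint_left.mp (hdisj p q hpq) (hm p) (h ▸ hm q)
  have hPinv : ∀ (c' : Cout) (x y : ℤ), Pinv c' x y =
      ∑ p, if ((m p).1 = c' ∧ (((m p).2.1 : ℕ) : ℤ) = x ∧ (((m p).2.2 : ℕ) : ℤ) = y)
        then Y p else 0 := by
    intro c' x y
    by_cases h : ∃ p, ((m p).1 = c' ∧ (((m p).2.1 : ℕ) : ℤ) = x ∧ (((m p).2.2 : ℕ) : ℤ) = y)
    · obtain ⟨p, rfl, rfl, rfl⟩ := h
      rw [hPinv1, Finset.sum_eq_single p]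
      · simp
      · intro q _ hq
        rw [if_neg]
        rintro ⟨h1, h2, h3⟩
        apply hq
        apply hinj
        refine Prod.ext h1 (Prod.ext (Fin.ext ?_) (Fin.ext ?_))
        · exact_mod_cast h2
        · exact_mod_cast h3
      · simp
    · rw [hPinv0 c' x y (not_exists.mp h)]
      symm
      exact Finset.sum_eq_zero fun p _ => if_neg (not_exists.mp h p)
  intro c x y
  have hg : ∀ (g : EuclideanSpace ℝ (Cin × Fin D × Fin D)) (i : Cin × Fin D × Fin D),
      g i = inner ℝ g (EuclideanSpace.single i (1 : ℝ)) := by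
    intro g i
    simp [EuclideanSpace.inner_single_right]
  rw [hg, gradient, InnerProductSpace.toDual_symm_apply, hF.fderiv]
  simp only [ContinuousLinearMap.sum_apply, ContinuousLinearMap.smul_apply, smul_eq_mul,
    convCLM_apply, hPinv, Finset.mul_sum]
  have hR : ∀ c' : Cout, (∑ r : Fin Fsz, ∑ s : Fin Fsz, ∑ p : P, W c' c r s *
      (if ((m p).1 = c' ∧ (((m p).2.1 : ℕ) : ℤ) = ((x : ℕ) : ℤ) - ((r : ℕ) : ℤ) ∧
        (((m p).2.2 : ℕ) : ℤ) = ((y : ℕ) : ℤ) - ((s : ℕ) : ℤ)) then Y p else 0)) =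
      ∑ p : P, ∑ r : Fin Fsz, ∑ s : Fin Fsz, W c' c r s *
      (if ((m p).1 = c' ∧ (((m p).2.1 : ℕ) : ℤ) = ((x : ℕ) : ℤ) - ((r : ℕ) : ℤ) ∧
        (((m p).2.2 : ℕ) : ℤ) = ((y : ℕ) : ℤ) - ((s : ℕ) : ℤ)) then Y p else 0) := by
    intro c'
    rw [Finset.sum_comm]
    simp_rw [Finset.sum_comm (t := (Finset.univ : Finset P))]
    refine Finset.sum_congr rfl fun p _ => ?_
    rw [Finset.sum_comm]
  simp_rw [hR]
  rw [Finset.sum_comm]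
  refine Finset.sum_congr rfl fun p _ => ?_
  rw [Finset.sum_eq_single (m p).1]
  · simp only [convByInput, Finset.mul_sum]
    rw [Finset.sum_eq_single c]
    · refine Finset.sum_congr rfl fun r _ => Finset.sum_congr rfl fun s _ => ?_
      have hiff : ((((m p).2.1 : ℕ) : ℤ) = ((x : ℕ) : ℤ) - ((r : ℕ) : ℤ) ∧
          (((m p).2.2 : ℕ) : ℤ) = ((y : ℕ) : ℤ) - ((s : ℕ) : ℤ)) ↔
          (((m p).2.1 : ℕ) + (r : ℕ) = x ∧ ((m p).2.2 : ℕ) + (s : ℕ) = y) := by omega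
      simp only [true_and, hiff, PiLp.single_apply, Prod.mk.injEq, Fin.ext_iff]
      split_ifs <;> ring
    · intro b _ hb
      refine Finset.sum_eq_zero fun r _ => Finset.sum_eq_zero fun s _ => ?_
      simp [PiLp.single_apply, hb]
    · simp
  · intro b _ hb
    refine Finset.sum_eq_zero fun r _ => Finset.sum_eq_zero fun s _ => ?_
    rw [if_neg (fun h => hb h.1.symm), mul_zero]
  · simp
end

section
/- Saw-tooth property of the BPTT gradients in a layered (bipartite) network: Suppose E = E_e × E_o and the transition function has the bipartite form F((e,o), θ) = (G(o,θ), H(e,θ)) (each block at time t+1 depends only on the other block at time t), and the cost depends only on the e-block: ℓ(e,o) = ℓ₀(e). Then for every 0 ≤ t ≤ T the BPTT state gradient ∇_s^BPTT(t) ∈ E_e × E_o has vanishing E_o-component when t is even and vanishing E_e-component when t is odd. -/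
open Filter Topology

/-- The transition function of a layered (bipartite) network: each block at time `t+1`
depends only on the other block at time `t`.  The state space is the ℓ²-product
`WithLp 2 (Ee × Eo)` of the even and odd blocks. -/
noncomputable def bipStep {Ee Eo Θ : Type*}
    [NormedAddCommGroup Ee] [InnerProductSpace ℝ Ee]
    [NormedAddCommGroup Eo] [InnerProductSpace ℝ Eo]
    [NormedAddCommGroup Θ] [InnerProductSpace ℝ Θ]
    (G : Eo × Θ → Ee) (H : Ee × Θ → Eo) (θ : Θ)
    (u : WithLp 2 (Ee × Eo)) : WithLp 2 (Ee × Eo) :=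
  (WithLp.equiv 2 (Ee × Eo)).symm
    (G ((WithLp.equiv 2 (Ee × Eo) u).2, θ), H ((WithLp.equiv 2 (Ee × Eo) u).1, θ))


theorem bip_iter {Ee Eo Θ : Type*}
    [NormedAddCommGroup Ee] [InnerProductSpace ℝ Ee]
    [NormedAddCommGroup Eo] [InnerProductSpace ℝ Eo]
    [NormedAddCommGroup Θ] [InnerProductSpace ℝ Θ]
    (G : Eo × Θ → Ee) (H : Ee × Θ → Eo) (θ : Θ) (t : ℕ) :
    ∀ u w : WithLp 2 (Ee × Eo),
    (Even t → u.fst = w.fst →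
      ((bipStep G H θ)^[t] u).fst = ((bipStep G H θ)^[t] w).fst) ∧
    (Odd t → u.snd = w.snd →
      ((bipStep G H θ)^[t] u).fst = ((bipStep G H θ)^[t] w).fst) := by
  induction t with
  | zero => intro u w; simp
  | succ n ih =>
    intro u w
    obtain ⟨h1, h2⟩ := ih (bipStep G H θ u) (bipStep G H θ w)
    simp only [Function.iterate_succ, Function.comp_apply]
    refine ⟨fun he h => h2 (by grind) ?_, fun ho h => h1 (by grind) ?_⟩
    · change H (u.fst, θ) = H (w.fst, θ)
      rw [h]
    · change G (u.snd, θ) = G (w.snd, θ)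
      rw [h]

/-- If `f` is invariant along `v`, its gradient is orthogonal to `v`. -/
theorem inner_gradient_eq_zero {V : Type*} [NormedAddCommGroup V] [InnerProductSpace ℝ V]
    [CompleteSpace V] (f : V → ℝ) (x v : V) (h : ∀ r : ℝ, f (x + r • v) = f x) :
    inner ℝ (gradient f x) v = 0 := by
  rw [gradient, InnerProductSpace.toDual_symm_apply]
  by_cases hd : DifferentiableAt ℝ f x
  · rw [← hd.lineDeriv_eq_fderiv, lineDeriv]
    simp [h]
  · simp [fderiv_zero_of_not_differentiableAt hd]

/-- Saw-tooth property of the BPTT gradients in a layered (bipartite) network: the BPTT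
state gradient has vanishing odd component at even times and vanishing even component at
odd times, when the cost depends only on the even block. -/
theorem bptt_sawtooth
    {Ee Eo Θ : Type*}
    [NormedAddCommGroup Ee] [InnerProductSpace ℝ Ee] [FiniteDimensional ℝ Ee]
    [NormedAddCommGroup Eo] [InnerProductSpace ℝ Eo] [FiniteDimensional ℝ Eo]
    [NormedAddCommGroup Θ] [InnerProductSpace ℝ Θ] [FiniteDimensional ℝ Θ]
    (G : Eo × Θ → Ee) (H : Ee × Θ → Eo) (ℓ₀ : Ee → ℝ)
    (hG : ContDiff ℝ 1 G) (hH : ContDiff ℝ 1 H) (hℓ₀ : ContDiff ℝ 1 ℓ₀)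
    (θ : Θ) (T : ℕ)
    (s : ℕ → WithLp 2 (Ee × Eo))
    (hs : ∀ t, t < T → s (t + 1) = bipStep G H θ (s t))
    (t : ℕ) (ht : t ≤ T) :
    (Even t →
      (WithLp.equiv 2 (Ee × Eo)
        (gradient
          (fun u : WithLp 2 (Ee × Eo) =>
            ℓ₀ ((WithLp.equiv 2 (Ee × Eo) ((bipStep G H θ)^[t] u)).1))
          (s (T - t)))).2 = 0) ∧
    (Odd t →
      (WithLp.equiv 2 (Ee × Eo)
        (gradient
          (fun u : WithLp 2 (Ee × Eo) =>
            ℓ₀ ((WithLp.equiv 2 (Ee × Eo) ((bipStep G H θ)^[t] u)).1))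
          (s (T - t)))).1 = 0) := by
  constructor
  · intro he
    set g := gradient (fun u : WithLp 2 (Ee × Eo) =>
            ℓ₀ ((WithLp.equiv 2 (Ee × Eo) ((bipStep G H θ)^[t] u)).1)) (s (T - t)) with hg
    have key := inner_gradient_eq_zero (fun u : WithLp 2 (Ee × Eo) =>
            ℓ₀ ((WithLp.equiv 2 (Ee × Eo) ((bipStep G H θ)^[t] u)).1)) (s (T - t))
            (WithLp.toLp 2 ((0 : Ee), g.snd))
            (fun r => congrArg ℓ₀ ((bip_iter G H θ t _ _).1 he (by simp)))
    rw [← hg, WithLp.prod_inner_apply] at key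
    change g.snd = 0
    simpa using key
  · intro ho
    set g := gradient (fun u : WithLp 2 (Ee × Eo) =>
            ℓ₀ ((WithLp.equiv 2 (Ee × Eo) ((bipStep G H θ)^[t] u)).1)) (s (T - t)) with hg
    have key := inner_gradient_eq_zero (fun u : WithLp 2 (Ee × Eo) =>
            ℓ₀ ((WithLp.equiv 2 (Ee × Eo) ((bipStep G H θ)^[t] u)).1)) (s (T - t))
            (WithLp.toLp 2 (g.fst, (0 : Eo)))
            (fun r => congrArg ℓ₀ ((bip_iter G H θ t _ _).2 ho (by simp)))
    rw [← hg, WithLp.prod_inner_apply] at key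
    change g.fst = 0
    simpa using key
end

section
/- Saw-tooth property of the EP neural updates in a layered (bipartite) network: Suppose E = E_e × E_o, the transition function has the bipartite form F((e,o), θ) = (G(o,θ), H(e,θ)), and ℓ(e,o) = ℓ₀(e) depends only on the e-block. Let s_* = (e_*, o_*) be a fixed point of F(·,θ). Then (i) the o-block is exactly unchanged after the first nudged step: the second component of s_1^β equals o_* for every β; and (ii) the limiting EP neural updates Δ_s^EP(t) = lim_{β→0} (s_{t+1}^β − s_t^β)/β have vanishing E_o-component when t is even and vanishing E_e-component when t is odd. -/
open Filter Topology

/-- The cost of a layered (bipartite) network depends only on the even block. -/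
noncomputable def bipLoss {Ee Eo : Type*}
    [NormedAddCommGroup Ee] [InnerProductSpace ℝ Ee]
    [NormedAddCommGroup Eo] [InnerProductSpace ℝ Eo]
    (ℓ₀ : Ee → ℝ) (u : WithLp 2 (Ee × Eo)) : ℝ :=
  ℓ₀ ((WithLp.equiv 2 (Ee × Eo) u).1)

/-- The nudged trajectory in components, defined for every real nudging parameter. -/
noncomputable def epAux {Ee Eo : Type*} [NormedAddCommGroup Ee] [InnerProductSpace ℝ Ee]
    [CompleteSpace Ee]
    [NormedAddCommGroup Eo] [InnerProductSpace ℝ Eo]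
    (g : Eo → Ee) (h : Ee → Eo) (ℓ₀ : Ee → ℝ) (s : Ee × Eo) : ℕ → ℝ → Ee × Eo
  | 0, _ => s
  | t + 1, β => (g (epAux g h ℓ₀ s t β).2 - β • gradient ℓ₀ (epAux g h ℓ₀ s t β).1,
      h (epAux g h ℓ₀ s t β).1)

/-- The derivative at zero of the trajectory. -/
noncomputable def epDer {Ee Eo : Type*} [NormedAddCommGroup Ee] [InnerProductSpace ℝ Ee]
    [NormedAddCommGroup Eo] [InnerProductSpace ℝ Eo]
    (g' : Eo →L[ℝ] Ee) (h' : Ee →L[ℝ] Eo) (v : Ee) : ℕ → Ee × Eo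
  | 0 => 0
  | t + 1 => (g' (epDer g' h' v t).2 - v, h' (epDer g' h' v t).1)

theorem epDer_saw {Ee Eo : Type*} [NormedAddCommGroup Ee] [InnerProductSpace ℝ Ee]
    [NormedAddCommGroup Eo] [InnerProductSpace ℝ Eo]
    (g' : Eo →L[ℝ] Ee) (h' : Ee →L[ℝ] Eo) (v : Ee) (t : ℕ) :
    (Even t → (epDer g' h' v (t + 1)).2 - (epDer g' h' v t).2 = 0) ∧
    (Odd t → (epDer g' h' v (t + 1)).1 - (epDer g' h' v t).1 = 0) := by
  induction t with
  | zero => simp [epDer]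
  | succ t ih =>
    constructor
    · intro ht
      have ht' : Odd t := by grind
      have := ih.2 ht'
      change h' (epDer g' h' v (t + 1)).1 - h' (epDer g' h' v t).1 = 0
      rw [← map_sub, this, map_zero]
    · intro ht
      have ht' : Even t := by grind
      have := ih.1 ht'
      change (g' (epDer g' h' v (t + 1)).2 - v) - (g' (epDer g' h' v t).2 - v) = 0
      rw [sub_sub_sub_cancel_right, ← map_sub, this, map_zero]

theorem bipLoss_gradient {Ee Eo : Type*}
    [NormedAddCommGroup Ee] [InnerProductSpace ℝ Ee] [CompleteSpace Ee]
    [NormedAddCommGroup Eo] [InnerProductSpace ℝ Eo] [CompleteSpace Eo]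
    (ℓ₀ : Ee → ℝ) (hℓ₀ : Differentiable ℝ ℓ₀) (u : WithLp 2 (Ee × Eo)) :
    gradient (bipLoss ℓ₀) u = WithLp.toLp 2 (gradient ℓ₀ u.fst, (0 : Eo)) := by
  apply HasGradientAt.gradient
  rw [hasGradientAt_iff_hasFDerivAt]
  have h1 : HasFDerivAt ℓ₀ _ u.fst := (hℓ₀ u.fst).hasGradientAt.hasFDerivAt
  have h2 := h1.comp u
    ((ContinuousLinearMap.fst ℝ Ee Eo).comp
      (WithLp.prodContinuousLinearEquiv 2 ℝ Ee Eo : WithLp 2 (Ee × Eo) →L[ℝ] Ee × Eo)).hasFDerivAt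
  refine HasFDerivAt.congr_fderiv (f := bipLoss ℓ₀) h2 ?_
  refine ContinuousLinearMap.ext fun x => ?_
  simp [WithLp.prod_inner_apply]

theorem epAux_zero {Ee Eo : Type*} [NormedAddCommGroup Ee] [InnerProductSpace ℝ Ee]
    [CompleteSpace Ee] [NormedAddCommGroup Eo] [InnerProductSpace ℝ Eo]
    (g : Eo → Ee) (h : Ee → Eo) (ℓ₀ : Ee → ℝ) (s : Ee × Eo)
    (hs1 : g s.2 = s.1) (hs2 : h s.1 = s.2) (t : ℕ) : epAux g h ℓ₀ s t 0 = s := by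
  induction t with
  | zero => rfl
  | succ t ih => rw [epAux, ih, hs1, hs2]; simp

theorem epAux_hasDerivAt {Ee Eo : Type*} [NormedAddCommGroup Ee] [InnerProductSpace ℝ Ee]
    [CompleteSpace Ee] [NormedAddCommGroup Eo] [InnerProductSpace ℝ Eo]
    (g : Eo → Ee) (h : Ee → Eo) (ℓ₀ : Ee → ℝ) (s : Ee × Eo)
    (hs1 : g s.2 = s.1) (hs2 : h s.1 = s.2)
    (hg : DifferentiableAt ℝ g s.2) (hh : DifferentiableAt ℝ h s.1)
    (hl : DifferentiableAt ℝ (gradient ℓ₀) s.1) (t : ℕ) :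
    HasDerivAt (epAux g h ℓ₀ s t)
      (epDer (fderiv ℝ g s.2) (fderiv ℝ h s.1) (gradient ℓ₀ s.1) t) 0 := by
  induction t with
  | zero => exact hasDerivAt_const _ _
  | succ t ih =>
    have h0 := epAux_zero g h ℓ₀ s hs1 hs2 t
    have i1 : HasDerivAt (fun β => (epAux g h ℓ₀ s t β).1) _ 0 := ih.fst
    have i2 : HasDerivAt (fun β => (epAux g h ℓ₀ s t β).2) _ 0 := ih.snd
    have a : HasDerivAt (fun β => g (epAux g h ℓ₀ s t β).2) _ 0 :=
      HasFDerivAt.comp_hasDerivAt (0 : ℝ) (l := g) (l' := fderiv ℝ g s.2)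
        (by rw [h0]; exact hg.hasFDerivAt) i2
    have b : HasDerivAt (fun β => h (epAux g h ℓ₀ s t β).1) _ 0 :=
      HasFDerivAt.comp_hasDerivAt (0 : ℝ) (l := h) (l' := fderiv ℝ h s.1)
        (by rw [h0]; exact hh.hasFDerivAt) i1
    have c : HasDerivAt (fun β => gradient ℓ₀ (epAux g h ℓ₀ s t β).1) _ 0 :=
      HasFDerivAt.comp_hasDerivAt (0 : ℝ) (l := gradient ℓ₀) (l' := fderiv ℝ (gradient ℓ₀) s.1)
        (by rw [h0]; exact hl.hasFDerivAt) i1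
    have d := (a.sub ((hasDerivAt_id (0 : ℝ)).smul c)).prodMk b
    refine d.congr_deriv ?_
    simp [epDer, h0]

/-- Saw-tooth property of the EP neural updates in a layered (bipartite) network:
(i) the odd block is exactly unchanged after the first nudged step, and (ii) the limiting
EP neural updates have vanishing odd component at even times and vanishing even component
at odd times. -/
theorem ep_sawtooth
    {Ee Eo Θ : Type*}
    [NormedAddCommGroup Ee] [InnerProductSpace ℝ Ee] [FiniteDimensional ℝ Ee]
    [NormedAddCommGroup Eo] [InnerProductSpace ℝ Eo] [FiniteDimensional ℝ Eo]
    [NormedAddCommGroup Θ] [InnerProductSpace ℝ Θ] [FiniteDimensional ℝ Θ]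
    (G : Eo × Θ → Ee) (H : Ee × Θ → Eo) (ℓ₀ : Ee → ℝ)
    (hG : ContDiff ℝ 2 G) (hH : ContDiff ℝ 2 H) (hℓ₀ : ContDiff ℝ 2 ℓ₀)
    (θ : Θ) (sstar : WithLp 2 (Ee × Eo)) (hfix : sstar = bipStep G H θ sstar)
    (sβ : ℝ → ℕ → WithLp 2 (Ee × Eo))
    (hsβ0 : ∀ β : ℝ, sβ β 0 = sstar)
    (hsβrec : ∀ β : ℝ, 0 < β → ∀ t,
      sβ β (t + 1) = bipStep G H θ (sβ β t) - β • gradient (bipLoss ℓ₀) (sβ β t)) :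
    (∀ β : ℝ, 0 < β →
      (WithLp.equiv 2 (Ee × Eo) (sβ β 1)).2 = (WithLp.equiv 2 (Ee × Eo) sstar).2) ∧
    ∃ Δ : ℕ → WithLp 2 (Ee × Eo),
      (∀ t, Filter.Tendsto (fun β : ℝ => β⁻¹ • (sβ β (t + 1) - sβ β t)) (𝓝[>] (0 : ℝ))
        (𝓝 (Δ t))) ∧
      ∀ t, (Even t → (WithLp.equiv 2 (Ee × Eo) (Δ t)).2 = 0) ∧
           (Odd t → (WithLp.equiv 2 (Ee × Eo) (Δ t)).1 = 0) := by
  have hgrad := bipLoss_gradient (Eo := Eo) ℓ₀ (hℓ₀.differentiable (by norm_num))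
  set g : Eo → Ee := fun o => G (o, θ) with hg
  set h : Ee → Eo := fun e => H (e, θ) with hh
  have hs1 : g sstar.snd = sstar.fst := (congrArg WithLp.fst hfix).symm
  have hs2 : h sstar.fst = sstar.snd := (congrArg WithLp.snd hfix).symm
  have hgd : Differentiable ℝ g :=
    (hG.differentiable (by norm_num)).comp (by fun_prop)
  have hhd : Differentiable ℝ h :=
    (hH.differentiable (by norm_num)).comp (by fun_prop)
  have hld : Differentiable ℝ (gradient ℓ₀) := by
    have h1 : Differentiable ℝ (fderiv ℝ ℓ₀) :=
      (hℓ₀.fderiv_right (m := 1) (by norm_num)).differentiable (by norm_num)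
    exact (InnerProductSpace.toDual ℝ Ee).symm.differentiable.comp h1
  have key : ∀ β : ℝ, 0 < β → ∀ t,
      sβ β t = WithLp.toLp 2 (epAux g h ℓ₀ (sstar.fst, sstar.snd) t β) := by
    intro β hβ t
    induction t with
    | zero => rw [hsβ0]; rfl
    | succ t ih =>
      rw [hsβrec β hβ t, hgrad, ih]
      refine (WithLp.equiv 2 (Ee × Eo)).injective (Prod.ext ?_ ?_)
      · simp [bipStep, epAux, hg]
      · simp [bipStep, epAux, hh]
  have hder := epAux_hasDerivAt g h ℓ₀ (sstar.fst, sstar.snd) hs1 hs2 (hgd _) (hhd _) (hld _)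
  set D := epDer (fderiv ℝ g sstar.snd) (fderiv ℝ h sstar.fst) (gradient ℓ₀ sstar.fst) with hD
  refine ⟨?_, fun t => WithLp.toLp 2 (D (t + 1) - D t), ?_, ?_⟩
  · intro β hβ
    rw [key β hβ 1]
    exact hs2
  · intro t
    have h1 := ((hder (t + 1)).sub (hder t)).tendsto_slope_zero_right
    have h2 := ((WithLp.prodContinuousLinearEquiv 2 ℝ Ee Eo).symm.continuous.tendsto _).comp h1
    refine h2.congr' ?_
    filter_upwards [self_mem_nhdsWithin] with β hβ
    rw [key β hβ, key β hβ]
    simp [epAux_zero g h ℓ₀ (sstar.fst, sstar.snd) hs1 hs2]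
  · intro t
    exact epDer_saw _ _ _ t
end

section
/- Truncated-sum corollary of the GDU theorem: Assume F(s,θ) = ∇_s Φ(s,θ) for a C³ primitive function Φ, and assume the first-phase trajectory satisfies s_{T−K} = s_{T−K+1} = … = s_T = s_* for some 0 < K ≤ T. Then the sum of the first K EP weight updates converges, as β → 0, to the negative of the sum of the first K BPTT parameter gradients: lim_{β→0} ∑_{t=1}^{K} Δ_θ^EP(β,t) = −∑_{t=1}^{K} ∇_θ^BPTT(t). -/
open Filter Topology

/-- Truncated-sum corollary of the GDU theorem: the sum of the first `K` EP weight updates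
converges, as `β → 0⁺`, to the negative of the sum of the first `K` BPTT parameter
gradients. -/
theorem gdu_truncated_sum
    {E : Type*} [NormedAddCommGroup E] [InnerProductSpace ℝ E] [FiniteDimensional ℝ E]
    {Θ : Type*} [NormedAddCommGroup Θ] [InnerProductSpace ℝ Θ] [FiniteDimensional ℝ Θ]
    (F : E × Θ → E) (ℓ : E → ℝ) (Φ : E × Θ → ℝ)
    (hF : ContDiff ℝ 2 F) (hℓ : ContDiff ℝ 2 ℓ) (hΦ : ContDiff ℝ 3 Φ)
    (hFΦ : ∀ (u : E) (θ : Θ), F (u, θ) = gradient (fun v => Φ (v, θ)) u)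
    (θ : Θ) (T K : ℕ) (hK0 : 0 < K) (hKT : K ≤ T)
    (s : ℕ → E) (hs : ∀ t, t < T → s (t + 1) = F (s t, θ))
    (sstar : E) (hstar : ∀ t, T - K ≤ t → t ≤ T → s t = sstar)
    (sβ : ℝ → ℕ → E)
    (hsβ0 : ∀ β : ℝ, sβ β 0 = sstar)
    (hsβrec : ∀ β : ℝ, 0 < β → ∀ t, sβ β (t + 1) = F (sβ β t, θ) - β • gradient ℓ (sβ β t)) :
    Filter.Tendsto
      (fun β : ℝ => ∑ t ∈ Finset.Icc 1 K, β⁻¹ •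
        (gradient (fun θ' => Φ (sβ β t, θ')) θ -
          gradient (fun θ' => Φ (sβ β (t - 1), θ')) θ))
      (𝓝[>] (0 : ℝ))
      (𝓝 (-∑ t ∈ Finset.Icc 1 K,
        gradient (fun θ' => ℓ ((fun v => F (v, θ))^[t - 1] (F (s (T - t), θ')))) θ)) := by
  have hfix : F (sstar, θ) = sstar := by
    have h1 := hs (T - K) (by omega)
    rw [hstar (T - K) le_rfl (by omega), hstar (T - K + 1) (by omega) (by omega)] at h1
    exact h1.symm
  have hΦd : Differentiable ℝ Φ := hΦ.differentiable (by norm_num)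
  have hΦ' : ContDiff ℝ 2 (fderiv ℝ Φ) := hΦ.fderiv_right (by norm_num)
  have hΦ'd : Differentiable ℝ (fderiv ℝ Φ) := hΦ'.differentiable (by norm_num)
  have hℓd : Differentiable ℝ ℓ := hℓ.differentiable (by norm_num)
  have hℓ' : ContDiff ℝ 1 (fderiv ℝ ℓ) := hℓ.fderiv_right (by norm_num)
  have hℓ'd : Differentiable ℝ (fderiv ℝ ℓ) := hℓ'.differentiable (by norm_num)
  have hgd : Differentiable ℝ (gradient ℓ) := by
    intro u
    exact (InnerProductSpace.toDual ℝ E).symm.toContinuousLinearEquiv.differentiableAt.comp u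
      (hℓ'd u)
  have hFd : Differentiable ℝ F := hF.differentiable (by norm_num)
  -- partial derivatives
  have hinl : ∀ (u : E) (θ : Θ), HasFDerivAt (fun v : E => (v, θ))
      (ContinuousLinearMap.inl ℝ E Θ) u := fun u θ => hasFDerivAt_prodMk_left u θ
  have hinr : ∀ (u : E) (θ : Θ), HasFDerivAt (fun v : Θ => (u, v))
      (ContinuousLinearMap.inr ℝ E Θ) θ := fun u θ => hasFDerivAt_prodMk_right u θ
  have hFin : ∀ (p : E × Θ) (w : E), inner ℝ (F p) w = fderiv ℝ Φ p (w, 0) := by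
    rintro ⟨u, θ⟩ w
    rw [hFΦ, gradient, InnerProductSpace.toDual_symm_apply]
    have h1 : HasFDerivAt (fun v => Φ (v, θ))
        ((fderiv ℝ Φ (u, θ)).comp (ContinuousLinearMap.inl ℝ E Θ)) u :=
      (hΦd (u, θ)).hasFDerivAt.comp u (hinl u θ)
    rw [h1.fderiv]
    simp
  set G : E → Θ := fun u => gradient (fun θ' => Φ (u, θ')) θ with hG
  have hGeq : ∀ u, G u = (InnerProductSpace.toDual ℝ Θ).symm
      ((fderiv ℝ Φ (u, θ)).comp (ContinuousLinearMap.inr ℝ E Θ)) := by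
    intro u
    simp only [hG, gradient]
    have h1 : HasFDerivAt (fun v => Φ (u, v))
        ((fderiv ℝ Φ (u, θ)).comp (ContinuousLinearMap.inr ℝ E Θ)) θ :=
      (hΦd (u, θ)).hasFDerivAt.comp θ (hinr u θ)
    rw [h1.fderiv]
  have hGin : ∀ u h, inner ℝ (G u) h = fderiv ℝ Φ (u, θ) (0, h) := by
    intro u h
    rw [hGeq, InnerProductSpace.toDual_symm_apply]; simp
  have hGd : Differentiable ℝ G := by
    have : G = fun u => (InnerProductSpace.toDual ℝ Θ).symm
      ((fderiv ℝ Φ (u, θ)).comp (ContinuousLinearMap.inr ℝ E Θ)) := funext hGeq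
    rw [this]
    intro u
    refine (InnerProductSpace.toDual ℝ Θ).symm.toContinuousLinearEquiv.differentiableAt.comp u ?_
    have h1 : DifferentiableAt ℝ (fun u => fderiv ℝ Φ (u, θ)) u :=
      DifferentiableAt.comp (g := fderiv ℝ Φ) u (hΦ'd (u, θ)) (hinl u θ).differentiableAt
    exact h1.clm_comp (differentiableAt_const _)
  set A := fderiv ℝ (fderiv ℝ Φ) (sstar, θ) with hA
  have hsymm : ∀ x y, A x y = A y x := by
    intro x y
    exact second_derivative_symmetric (fun p => (hΦd p).hasFDerivAt)
      (hΦ'd (sstar, θ)).hasFDerivAt x y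
  set F' := fderiv ℝ F (sstar, θ) with hF'
  have hF'in : ∀ x w, inner ℝ (F' x) w = A x (w, 0) := by
    intro x w
    have h1 : HasFDerivAt (fun p => inner ℝ (F p) w) _ (sstar, θ) :=
      (hFd (sstar, θ)).hasFDerivAt.inner ℝ (hasFDerivAt_const w _)
    have h2 : HasFDerivAt (fun p => fderiv ℝ Φ p (w, 0)) _ (sstar, θ) :=
      (hΦ'd (sstar, θ)).hasFDerivAt.clm_apply (hasFDerivAt_const ((w, 0) : E × Θ) _)
    have h3 : (fun p => inner ℝ (F p) w) = (fun p => fderiv ℝ Φ p (w, 0)) :=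
      funext fun p => hFin p w
    rw [h3] at h1
    have := congrArg (fun L => L x) (h1.unique h2)
    simpa using this
  set G' := fderiv ℝ G sstar with hG'
  have hG'in : ∀ w h, inner ℝ (G' w) h = A (w, 0) (0, h) := by
    intro w h
    have h1 : HasFDerivAt (fun p => inner ℝ (G p) h) _ sstar :=
      (hGd sstar).hasFDerivAt.inner ℝ (hasFDerivAt_const h _)
    have h0 : HasFDerivAt (fun u => fderiv ℝ Φ (u, θ))
        (A.comp (ContinuousLinearMap.inl ℝ E Θ)) sstar :=
      HasFDerivAt.comp (g := fderiv ℝ Φ) sstar (hΦ'd (sstar, θ)).hasFDerivAt (hinl sstar θ)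
    have h2 : HasFDerivAt (fun u => fderiv ℝ Φ (u, θ) (0, h)) _ sstar :=
      h0.clm_apply (hasFDerivAt_const ((0, h) : E × Θ) _)
    have h3 : (fun p => inner ℝ (G p) h) = (fun u => fderiv ℝ Φ (u, θ) (0, h)) :=
      funext fun p => hGin p h
    rw [h3] at h1
    have := congrArg (fun L => L w) (h1.unique h2)
    simpa using this
  set J : E →L[ℝ] E := F'.comp (ContinuousLinearMap.inl ℝ E Θ) with hJ
  have hJd : HasFDerivAt (fun v => F (v, θ)) J sstar :=
    (hFd (sstar, θ)).hasFDerivAt.comp sstar (hinl sstar θ)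
  have hBd : HasFDerivAt (fun v => F (sstar, v)) (F'.comp (ContinuousLinearMap.inr ℝ E Θ)) θ :=
    (hFd (sstar, θ)).hasFDerivAt.comp θ (hinr sstar θ)
  have hJs : ∀ x y, inner ℝ (J x) y = inner ℝ x (J y) := by
    intro x y
    rw [real_inner_comm (J y) x]
    simp only [hJ, ContinuousLinearMap.comp_apply, ContinuousLinearMap.inl_apply]
    rw [hF'in, hF'in, hsymm]
  have hJn : ∀ (n : ℕ) x y, inner ℝ ((J ^ n) x) y = inner ℝ x ((J ^ n) y) := by
    intro n
    induction n with
    | zero => intro x y; simp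
    | succ n ih =>
      intro x y
      rw [pow_succ, mul_apply_eq_comp, ih, hJs, ← mul_apply_eq_comp,
        ← pow_succ', pow_succ]
  set g := gradient ℓ sstar with hg
  -- trajectory
  let S : ℕ → ℝ → E := fun t => Nat.rec (fun _ => sstar)
    (fun _ f β => F (f β, θ) - β • gradient ℓ (f β)) t
  have hS0 : ∀ β, S 0 β = sstar := fun β => rfl
  have hSs : ∀ t, S (t + 1) = fun β => F (S t β, θ) - β • gradient ℓ (S t β) := fun t => rfl
  have hSsβ : ∀ β, 0 < β → ∀ t, sβ β t = S t β := by
    intro β hβ t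
    induction t with
    | zero => rw [hsβ0, hS0]
    | succ t ih => rw [hsβrec β hβ, hSs, ih]
  have hSz : ∀ t, S t 0 = sstar := by
    intro t
    induction t with
    | zero => rfl
    | succ t ih => simp only [hSs, ih, hfix, zero_smul, sub_zero]
  have hSd : ∀ t, HasDerivAt (S t) (-∑ j ∈ Finset.range t, (J ^ j) g) 0 := by
    intro t
    induction t with
    | zero =>
      rw [Finset.range_zero, Finset.sum_empty, neg_zero]
      exact hasDerivAt_const (0 : ℝ) sstar
    | succ t ih =>
      rw [hSs]
      have h0 : HasFDerivAt (fun v => F (v, θ)) J (S t 0) := by rw [hSz]; exact hJd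
      have h1 : HasDerivAt (fun β => F (S t β, θ)) (J (-∑ j ∈ Finset.range t, (J ^ j) g)) 0 :=
        HasFDerivAt.comp_hasDerivAt (l := fun v => F (v, θ)) (0 : ℝ) h0 ih
      have h2 : HasDerivAt (fun β => gradient ℓ (S t β)) _ 0 :=
        HasFDerivAt.comp_hasDerivAt (l := gradient ℓ) (0 : ℝ) (hgd (S t 0)).hasFDerivAt ih
      have h3 := h1.sub ((hasDerivAt_id (0 : ℝ)).smul h2)
      convert h3 using 1
      · rfl
      rw [Finset.sum_range_succ']
      simp [hSz, pow_succ', ← hg]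
      abel
  have hGS : HasDerivAt (fun β => G (S K β)) (G' (-∑ j ∈ Finset.range K, (J ^ j) g)) 0 :=
by
    have h0 : HasFDerivAt G G' (S K 0) := by rw [hSz]; exact (hGd sstar).hasFDerivAt
    exact HasFDerivAt.comp_hasDerivAt (0 : ℝ) h0 (hSd K)
  have hlim := hGS.tendsto_slope_zero_right
  have hIcc : ∀ {M : Type _} [AddCommMonoid M] (f : ℕ → M),
      ∑ t ∈ Finset.Icc 1 K, f t = ∑ j ∈ Finset.range K, f (j + 1) := by
    intro M _ f
    rw [Finset.range_eq_Ico, Finset.sum_Ico_add' f 0 K 1]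
    rfl
  have hval : G' (-∑ j ∈ Finset.range K, (J ^ j) g) = -∑ t ∈ Finset.Icc 1 K,
        gradient (fun θ' => ℓ ((fun v => F (v, θ))^[t - 1] (F (s (T - t), θ')))) θ := by
    rw [hIcc, map_neg, map_sum]
    congr 1
    refine Finset.sum_congr rfl fun j hj => ?_
    have hj' := Finset.mem_range.mp hj
    rw [hstar (T - (j + 1)) (by omega) (by omega)]
    refine ext_inner_right ℝ fun h => ?_
    rw [gradient, InnerProductSpace.toDual_symm_apply, hG'in, hsymm, ← hF'in]
    have e1 : HasFDerivAt (fun v => F (v, θ))^[j] (J ^ j) (F (sstar, θ)) := by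
      rw [hfix]; exact hJd.iterate hfix j
    have e2 : (fun v => F (v, θ))^[j] (F (sstar, θ)) = sstar := by
      rw [hfix]; exact Function.iterate_fixed hfix j
    have e3 : HasFDerivAt ℓ (fderiv ℝ ℓ sstar) ((fun v => F (v, θ))^[j] (F (sstar, θ))) := by
      rw [e2]; exact (hℓd sstar).hasFDerivAt
    have e4 : HasFDerivAt (fun θ' => ℓ ((fun v => F (v, θ))^[j] (F (sstar, θ')))) _ θ :=
      e3.comp θ (e1.comp θ hBd)
    rw [Nat.add_sub_cancel, e4.fderiv]
    simp only [ContinuousLinearMap.comp_apply, ContinuousLinearMap.inr_apply]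
    rw [real_inner_comm, hJn, hg, gradient, InnerProductSpace.toDual_symm_apply]
  rw [← hval]
  refine hlim.congr' ?_
  filter_upwards [self_mem_nhdsWithin] with β hβ
  rw [hIcc, ← Finset.smul_sum]
  have := Finset.sum_range_sub (fun t => G (sβ β t)) K
  simp only [Nat.add_sub_cancel]
  change _ = β⁻¹ • ∑ t ∈ Finset.range K, (G (sβ β (t + 1)) - G (sβ β t))
  rw [this, hsβ0, hSsβ β hβ, zero_add, hSz]
end
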